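/- (Decay of the velocity for large viscosity in 2D.) Let η > 0 and ν > 3η, let r ≥ 0 be an integer and N > 1. Let u₀, b₀ : 𝕋² → ℝ² be smooth divergence-free fields with zero average satisfying ‖u₀‖_{H^j} + ‖b₀‖_{H^j} ≤ C₁ N^j for all integers 0 ≤ j ≤ r, and let (u, b, P) be the unique global smooth solution of the MHD system on 𝕋² with initial datum (u₀, b₀). Set Γ = 1 + ‖u₀‖²_{L²} + ‖b₀‖²_{L²}. Then there is a constant C depending only on r and C₁ such that for all t ≥ 0: ‖∇^r u(t,·)‖²_{L²} ≤ (‖∇^r u₀‖²_{L²} + C·e^{νt}e^{−ηt}·N^{2r}/(νη))·e^{CΓ/η²}·e^{−νt}. -/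

import Mathlib

open MeasureTheory Real Set

noncomputable section

/-- Partial derivative of a scalar function on `ℝ^d` in the `i`-th coordinate direction. -/
def pd {d : ℕ} (i : Fin d) (f : (Fin d → ℝ) → ℝ) : (Fin d → ℝ) → ℝ :=
  fun x => fderiv ℝ f x (Pi.single i 1)

/-- Iterated partial derivative along a list of directions. -/
def pdList {d : ℕ} : List (Fin d) → ((Fin d → ℝ) → ℝ) → ((Fin d → ℝ) → ℝ)
  | [], f => f
  | i :: l, f => pd i (pdList l f)

/-- The list of directions associated to a multi-index `α`
(the direction `i` repeated `α i` times). -/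
def mIdxList {d : ℕ} (α : Fin d → ℕ) : List (Fin d) :=
  ((List.finRange d).map fun i => List.replicate (α i) i).flatten

/-- The partial derivative `∂^α f` for a multi-index `α`. -/
def pdM {d : ℕ} (α : Fin d → ℕ) (f : (Fin d → ℝ) → ℝ) : (Fin d → ℝ) → ℝ :=
  pdList (mIdxList α) f

/-- `|∇^m w|²(x) = ∑_{|α| = m} |∂^α w(x)|²` for a vector field `w : ℝ^d → ℝ^k`. -/
def gradSq {d k : ℕ} (m : ℕ) (w : (Fin d → ℝ) → Fin k → ℝ) (x : Fin d → ℝ) : ℝ :=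
  ∑ α ∈ Finset.Nat.antidiagonalTuple d m, ∑ i, pdM α (fun y => w y i) x ^ 2

/-- The fundamental domain `[0,L]^d` of the torus `ℝ^d/(Lℤ)^d`. -/
def box (d : ℕ) (L : ℝ) : Set (Fin d → ℝ) := Set.Icc 0 fun _ => L

/-- Square of the Sobolev `H^r` norm on the torus of period `L`. -/
def HnormSq {d k : ℕ} (L : ℝ) (r : ℕ) (w : (Fin d → ℝ) → Fin k → ℝ) : ℝ :=
  ∑ m ∈ Finset.range (r + 1), ∫ x in box d L, gradSq m w x

/-- The Sobolev `H^r` norm on the torus of period `L`. -/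
def Hnorm {d k : ℕ} (L : ℝ) (r : ℕ) (w : (Fin d → ℝ) → Fin k → ℝ) : ℝ :=
  Real.sqrt (HnormSq L r w)

/-- The `L²` norm on the torus of period `L`. -/
def L2norm {d k : ℕ} (L : ℝ) (w : (Fin d → ℝ) → Fin k → ℝ) : ℝ :=
  Real.sqrt (∫ x in box d L, ∑ i, w x i ^ 2)

/-- The `L^∞` norm of `∇^m w`. -/
def LinfGrad {d k : ℕ} (m : ℕ) (w : (Fin d → ℝ) → Fin k → ℝ) : ℝ :=
  ⨆ x : Fin d → ℝ, Real.sqrt (gradSq m w x)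

/-- The `L^∞` norm of `w`. -/
def Linf {d k : ℕ} (w : (Fin d → ℝ) → Fin k → ℝ) : ℝ := LinfGrad 0 w

/-- `L`-periodicity in each coordinate direction. -/
def Prdc {d : ℕ} {E : Type*} (L : ℝ) (w : (Fin d → ℝ) → E) : Prop :=
  ∀ (x : Fin d → ℝ) (i : Fin d), w (x + Pi.single i L) = w x

/-- Zero average on the torus. -/
def ZeroAvg {d k : ℕ} (L : ℝ) (w : (Fin d → ℝ) → Fin k → ℝ) : Prop :=
  ∀ i, (∫ x in box d L, w x i) = 0

/-- Divergence of a vector field on `ℝ^d`. -/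
def divg {d : ℕ} (w : (Fin d → ℝ) → Fin d → ℝ) (x : Fin d → ℝ) : ℝ :=
  ∑ i, pd i (fun y => w y i) x

/-- A smooth solution of the MHD system with viscosity `ν` and resistivity `η` on the torus
`ℝ^d/(Lℤ)^d`, on the time interval `J` (the equations are imposed at positive times of `J`). -/
structure IsMHD (d : ℕ) (L ν η : ℝ) (J : Set ℝ)
    (u b : ℝ → (Fin d → ℝ) → Fin d → ℝ) (P : ℝ → (Fin d → ℝ) → ℝ) : Prop where
  smooth_u : ContDiffOn ℝ (⊤ : ℕ∞) (fun p : ℝ × (Fin d → ℝ) => u p.1 p.2) (J ×ˢ Set.univ)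
  smooth_b : ContDiffOn ℝ (⊤ : ℕ∞) (fun p : ℝ × (Fin d → ℝ) => b p.1 p.2) (J ×ˢ Set.univ)
  smooth_P : ContDiffOn ℝ (⊤ : ℕ∞) (fun p : ℝ × (Fin d → ℝ) => P p.1 p.2) (J ×ˢ Set.univ)
  periodic_u : ∀ t ∈ J, Prdc L (u t)
  periodic_b : ∀ t ∈ J, Prdc L (b t)
  periodic_P : ∀ t ∈ J, Prdc L (P t)
  div_u : ∀ t ∈ J, ∀ x, divg (u t) x = 0
  div_b : ∀ t ∈ J, ∀ x, divg (b t) x = 0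
  momentum : ∀ t ∈ J, 0 < t → ∀ x i,
    deriv (fun s => u s x i) t + (∑ j, u t x j * pd j (fun y => u t y i) x) + pd i (P t) x
      = ν * (∑ j, pd j (pd j fun y => u t y i) x) + ∑ j, b t x j * pd j (fun y => b t y i) x
  induction_eq : ∀ t ∈ J, 0 < t → ∀ x i,
    deriv (fun s => b s x i) t + (∑ j, u t x j * pd j (fun y => b t y i) x)
      = (∑ j, b t x j * pd j (fun y => u t y i) x)
        + η * (∑ j, pd j (pd j fun y => b t y i) x)

/-- Projection from `ℝ^d` onto the torus `ℝ^d/(Lℤ)^d`. -/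
def torusProj (d : ℕ) (L : ℝ) (x : Fin d → ℝ) : Fin d → AddCircle L :=
  fun i => (x i : AddCircle L)

/-- A magnetic line of the field `b`: the image on the torus of a maximal (hence, since the
relevant fields are smooth and periodic, globally defined) integral curve of `b`. -/
def IsMagLine (d : ℕ) (L : ℝ) (b : (Fin d → ℝ) → Fin d → ℝ)
    (s : Set (Fin d → AddCircle L)) : Prop :=
  ∃ γ : ℝ → Fin d → ℝ, (∀ τ : ℝ, HasDerivAt γ (b (γ τ)) τ) ∧
    s = torusProj d L '' Set.range γ

/-- The families of magnetic lines of `b₁` and `b₂` are topologically equivalent: some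
self-homeomorphism of the torus maps the family of magnetic lines of `b₁` bijectively onto the
family of magnetic lines of `b₂`. -/
def MagLinesEquiv (d : ℕ) (L : ℝ) (b₁ b₂ : (Fin d → ℝ) → Fin d → ℝ) : Prop :=
  ∃ φ : (Fin d → AddCircle L) ≃ₜ (Fin d → AddCircle L),
    ∀ s : Set (Fin d → AddCircle L), IsMagLine d L b₁ s ↔ IsMagLine d L b₂ (φ '' s)

/-- A commutative algebra with two commuting derivations and an integration functional,
modelled on the smooth functions on the flat two-dimensional torus. -/
structure TorusCalculus (A : Type*) [CommRing A] [Algebra ℝ A] where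
  D : Fin 2 → Derivation ℝ A A
  I : A →ₗ[ℝ] ℝ
  comm : ∀ i j a, D i (D j a) = D j (D i a)
  I_D : ∀ i a, I (D i a) = 0
  I_nonneg : ∀ a, 0 ≤ I (a * a)
  poincare : ∀ a, I a = 0 → I (a * a) ≤ ∑ i, I (D i a * D i a)
  agmon : ∀ a, ∀ s : ℝ, 0 < s → I (a ^ 4) ≤
    ((1 + s) * I (a * a) + s⁻¹ * I (D 0 a * D 0 a)) *
    ((1 + s) * I (a * a) + s⁻¹ * I (D 1 a * D 1 a))

/-- A nonnegative log-convex sequence satisfies `a (i+1) * a j ≤ a i * a (j+1)` for `i ≤ j`. -/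
theorem logConvex_step {a : ℕ → ℝ} (h0 : ∀ k, 0 ≤ a k)
    (h : ∀ k, a (k + 1) ^ 2 ≤ a k * a (k + 2)) (i n : ℕ) :
    a (i + 1) * a (i + n) ≤ a i * a (i + n + 1) := by
  induction n with
  | zero => simp [mul_comm]
  | succ n ih =>
    rcases (h0 (i + n + 1)).eq_or_lt with h1 | h1
    · rw [← add_assoc, ← h1, mul_zero]
      exact mul_nonneg (h0 _) (h0 _)
    · have h2 := h (i + n)
      have h3 : a (i + 1) * a (i + n + 1) * a (i + n + 1)
          ≤ a i * a (i + n + 2) * a (i + n + 1) := by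
        calc a (i + 1) * a (i + n + 1) * a (i + n + 1)
            = a (i + 1) * a (i + n + 1) ^ 2 := by ring
          _ ≤ a (i + 1) * (a (i + n) * a (i + n + 2)) :=
              mul_le_mul_of_nonneg_left h2 (h0 _)
          _ = (a (i + 1) * a (i + n)) * a (i + n + 2) := by ring
          _ ≤ (a i * a (i + n + 1)) * a (i + n + 2) :=
              mul_le_mul_of_nonneg_right ih (h0 _)
          _ = _ := by ring
      exact le_of_mul_le_mul_right h3 h1

theorem logConvex_mul_le_zero {a : ℕ → ℝ} (h0 : ∀ k, 0 ≤ a k)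
    (h : ∀ k, a (k + 1) ^ 2 ≤ a k * a (k + 2)) (i j : ℕ) :
    a i * a j ≤ a 0 * a (i + j) := by
  wlog hij : i ≤ j generalizing i j
  · rw [mul_comm, add_comm]
    exact this j i (by omega)
  induction i generalizing j with
  | zero => simp
  | succ i ih =>
    obtain ⟨n, rfl⟩ := Nat.exists_eq_add_of_le (show i ≤ j by omega)
    refine (logConvex_step h0 h i n).trans ((ih (i + n + 1) (by omega)).trans_eq ?_)
    congr 2; omega

theorem logConvex_mul_le {a : ℕ → ℝ} (h0 : ∀ k, 0 ≤ a k)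
    (h : ∀ k, a (k + 1) ^ 2 ≤ a k * a (k + 2)) (s i j : ℕ) :
    a (s + i) * a (s + j) ≤ a s * a (s + i + j) := by
  have := logConvex_mul_le_zero (a := fun k => a (s + k)) (fun k => h0 _) (fun k => h (s + k)) i j
  simpa [add_assoc] using this

namespace TorusCalculus

variable {A : Type*} [CommRing A] [Algebra ℝ A] (T : TorusCalculus A)

/-- Iterated derivation along a word. -/
def dl : List (Fin 2) → A → A
  | [], a => a
  | i :: l, a => T.D i (dl l a)

/-- Square of the `L²` norm of the full `k`-th gradient. -/
def ns : ℕ → A → ℝ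
  | 0, a => T.I (a * a)
  | k + 1, a => ∑ j, ns k (T.D j a)

theorem ns_nonneg (k : ℕ) (a : A) : 0 ≤ T.ns k a := by
  induction k generalizing a with
  | zero => exact T.I_nonneg a
  | succ k ih => exact Finset.sum_nonneg fun j _ => ih _

theorem I_mul_sq_le (a b : A) : T.I (a * b) ^ 2 ≤ T.I (a * a) * T.I (b * b) := by
  have h : ∀ x : ℝ, 0 ≤ T.I (a * a) * (x * x) + (2 * T.I (a * b)) * x + T.I (b * b) := by
    intro x
    have h1 := T.I_nonneg (x • a + b)
    have h2 : (x • a + b) * (x • a + b) = (x * x) • (a * a) + (2 * x) • (a * b) + b * b := by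
      simp only [Algebra.smul_def, map_mul, map_ofNat]; ring
    rw [h2] at h1
    simp only [map_add, map_smul, smul_eq_mul] at h1
    linarith
  have := discrim_le_zero h
  rw [discrim] at this
  nlinarith

theorem I_mul_D (i : Fin 2) (a b : A) : T.I (a * T.D i b) = -T.I (T.D i a * b) := by
  have h := T.I_D i (a * b)
  rw [Derivation.leibniz] at h
  simp only [smul_eq_mul, map_add] at h
  rw [mul_comm (T.D i a) b]
  linarith

theorem D_dl (i : Fin 2) (l : List (Fin 2)) (a : A) : T.D i (T.dl l a) = T.dl l (T.D i a) := by
  induction l with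
  | nil => rfl
  | cons j l ih => simp only [dl]; rw [T.comm, ih]

theorem dl_add (l : List (Fin 2)) (a b : A) : T.dl l (a + b) = T.dl l a + T.dl l b := by
  induction l with
  | nil => rfl
  | cons j l ih => simp only [dl, ih, map_add]

theorem dl_smul (l : List (Fin 2)) (c : ℝ) (a : A) : T.dl l (c • a) = c • T.dl l a := by
  induction l with
  | nil => rfl
  | cons j l ih => simp only [dl, ih, Derivation.map_smul]

/-- `dl` as a linear map. -/
def dlₗ (l : List (Fin 2)) : A →ₗ[ℝ] A where
  toFun := T.dl l
  map_add' := T.dl_add l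
  map_smul' := T.dl_smul l

theorem dlₗ_apply (l : List (Fin 2)) (a : A) : T.dlₗ l a = T.dl l a := rfl

theorem I_dl_sq_le_ns (l : List (Fin 2)) (a : A) :
    T.I (T.dl l a * T.dl l a) ≤ T.ns l.length a := by
  induction l generalizing a with
  | nil => exact le_rfl
  | cons i l ih =>
    simp only [dl, List.length_cons, ns]
    rw [D_dl]
    exact (ih _).trans (Finset.single_le_sum (f := fun j => T.ns l.length (T.D j a))
      (fun j _ => T.ns_nonneg _ _) (Finset.mem_univ i))

theorem sum_I_D_dl_sq_le_ns (l : List (Fin 2)) (a : A) :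
    ∑ i, T.I (T.D i (T.dl l a) * T.D i (T.dl l a)) ≤ T.ns (l.length + 1) a := by
  simp only [ns, D_dl]
  exact Finset.sum_le_sum fun i _ => T.I_dl_sq_le_ns l _

theorem ns_zero_logConvex (a : A) : T.ns 1 a ^ 2 ≤ T.ns 0 a * T.ns 2 a := by
  have h1 : T.ns 1 a = -T.I (a * ∑ j, T.D j (T.D j a)) := by
    simp only [ns, Finset.mul_sum, map_sum, I_mul_D]
    simp
  have h2 : T.ns 2 a = T.I ((∑ j, T.D j (T.D j a)) * ∑ j, T.D j (T.D j a)) := by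
    simp only [ns, Fin.sum_univ_two, mul_add, add_mul, map_add]
    have e : T.I (T.D 0 (T.D 1 a) * T.D 0 (T.D 1 a))
        = T.I (T.D 1 (T.D 1 a) * T.D 0 (T.D 0 a)) := by
      have h3 := T.I_mul_D 0 (T.D 0 (T.D 1 a)) (T.D 1 a)
      have h4 := T.I_mul_D 1 (T.D 0 (T.D 0 a)) (T.D 1 a)
      rw [T.comm 1 0 (T.D 0 a), T.comm 1 0 a] at h4
      rw [mul_comm (T.D 1 (T.D 1 a)), h4, h3]
    rw [T.comm 1 0 a, e, mul_comm (T.D 0 (T.D 0 a)) (T.D 1 (T.D 1 a))]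
  rw [h1, h2, neg_sq]
  exact T.I_mul_sq_le _ _

theorem sum_sq_le_of_sq_le {ι : Type*} (s : Finset ι) {x y z : ι → ℝ} (hx : ∀ i, 0 ≤ x i)
    (hz : ∀ i, 0 ≤ z i) (h : ∀ i, y i ^ 2 ≤ x i * z i) :
    (∑ i ∈ s, y i) ^ 2 ≤ (∑ i ∈ s, x i) * ∑ i ∈ s, z i :=
  Finset.sum_sq_le_sum_mul_sum_of_sq_le_mul s (fun i _ => hx i) (fun i _ => hz i) (fun i _ => h i)

theorem ns_logConvex (k : ℕ) (a : A) : T.ns (k + 1) a ^ 2 ≤ T.ns k a * T.ns (k + 2) a := by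
  induction k generalizing a with
  | zero => exact T.ns_zero_logConvex a
  | succ k ih =>
    exact sum_sq_le_of_sq_le _ (fun i => T.ns_nonneg _ _) (fun i => T.ns_nonneg _ _)
      (fun i => ih _)

theorem ladyzhenskaya (a : A) (ha : T.I a = 0) :
    T.I (a ^ 4) ≤ 9 * T.I (a * a) * ∑ i, T.I (T.D i a * T.D i a) := by
  have hp := T.poincare a ha
  set X := T.I (a * a) with hX
  set Y := ∑ i, T.I (T.D i a * T.D i a) with hY
  have hX0 : 0 ≤ X := T.I_nonneg a
  have h0 := T.I_nonneg (T.D 0 a)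
  have h1 := T.I_nonneg (T.D 1 a)
  rw [Fin.sum_univ_two] at hY
  rcases hX0.eq_or_lt with h | h
  · have := T.I_mul_sq_le a (a ^ 3)
    rw [← hX, ← h, zero_mul] at this
    have h2 : a * a ^ 3 = a ^ 4 := by ring
    rw [h2] at this
    have h3 : T.I (a ^ 4) = 0 := by nlinarith
    rw [h3, ← h]; simp
  · have hY0 : 0 < Y := lt_of_lt_of_le h hp
    set p := Real.sqrt X with hpd
    set q := Real.sqrt Y with hqd
    have hp0 : 0 < p := Real.sqrt_pos.2 h
    have hq0 : 0 < q := Real.sqrt_pos.2 hY0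
    have hpp : X = p ^ 2 := (Real.sq_sqrt hX0).symm
    have hqq : Y = q ^ 2 := (Real.sq_sqrt hY0.le).symm
    have hpq : p ≤ q := Real.sqrt_le_sqrt hp
    have key := T.agmon a (q / p) (by positivity)
    rw [← hX] at key
    have b : ∀ Z, 0 ≤ Z → Z ≤ Y → (1 + q / p) * X + (q / p)⁻¹ * Z ≤ 3 * (p * q) := by
      intro Z hZ0 hZ
      have e1 : (1 + q / p) * X = p ^ 2 + p * q := by rw [hpp]; field_simp
      have e2 : (q / p)⁻¹ * Z ≤ p * q := by
        calc (q / p)⁻¹ * Z ≤ (q / p)⁻¹ * Y := by gcongr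
          _ = p * q := by rw [hqq]; field_simp
      rw [e1]; nlinarith
    refine key.trans ?_
    calc _ ≤ (3 * (p * q)) * (3 * (p * q)) := by
            refine mul_le_mul (b _ h0 (by linarith)) (b _ h1 (by linarith)) ?_ (by positivity)
            positivity
      _ = 9 * X * Y := by rw [hpp, hqq]; ring

theorem I_dl_eq_zero (l : List (Fin 2)) (a : A) (ha : T.I a = 0) : T.I (T.dl l a) = 0 := by
  cases l with
  | nil => exact ha
  | cons i l => exact T.I_D i _

theorem I_dl_pow_four_le (l : List (Fin 2)) (a : A) (ha : T.I a = 0) :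
    T.I (T.dl l a ^ 4) ≤ 9 * (T.ns l.length a * T.ns (l.length + 1) a) := by
  have h := T.ladyzhenskaya _ (T.I_dl_eq_zero l a ha)
  have h1 := T.I_dl_sq_le_ns l a
  have h2 := T.sum_I_D_dl_sq_le_ns l a
  have h3 := T.I_nonneg (T.dl l a)
  have h4 := mul_le_mul h1 h2 (Finset.sum_nonneg fun i _ => T.I_nonneg _) (T.ns_nonneg _ _)
  linarith

section Family

variable {ι : Type*} [Fintype ι] (W : ι → A)

/-- Square of the `L²` norm of the `k`-th gradient of a family of functions. -/
def fs (k : ℕ) : ℝ := ∑ c, T.ns k (W c)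

theorem fs_nonneg (k : ℕ) : 0 ≤ T.fs W k := Finset.sum_nonneg fun _ _ => T.ns_nonneg _ _

theorem ns_le_fs (k : ℕ) (c : ι) : T.ns k (W c) ≤ T.fs W k :=
  Finset.single_le_sum (f := fun c => T.ns k (W c)) (fun _ _ => T.ns_nonneg _ _)
    (Finset.mem_univ c)

theorem fs_logConvex (k : ℕ) : T.fs W (k + 1) ^ 2 ≤ T.fs W k * T.fs W (k + 2) :=
  sum_sq_le_of_sq_le _ (fun _ => T.ns_nonneg _ _) (fun _ => T.ns_nonneg _ _)
    (fun _ => T.ns_logConvex _ _)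

variable {W} (hW : ∀ c, T.I (W c) = 0)
include hW

theorem I_dl_mul_sq_le (m n : List (Fin 2)) (a b : ι) :
    T.I ((T.dl m (W a) * T.dl n (W b)) * (T.dl m (W a) * T.dl n (W b))) ^ 2 ≤
      81 * ((T.fs W m.length * T.fs W (n.length + 1)) *
        (T.fs W n.length * T.fs W (m.length + 1))) := by
  have h := T.I_mul_sq_le (T.dl m (W a) ^ 2) (T.dl n (W b) ^ 2)
  have e1 : ∀ x : A, x ^ 2 * x ^ 2 = x ^ 4 := fun x => by ring
  have e2 : ∀ x y : A, (x * y) * (x * y) = x ^ 2 * y ^ 2 := fun x y => by ring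
  rw [e1, e1] at h
  rw [e2]
  have h1 := T.I_dl_pow_four_le m _ (hW a)
  have h2 := T.I_dl_pow_four_le n _ (hW b)
  have p1 : T.ns m.length (W a) * T.ns (m.length + 1) (W a)
      ≤ T.fs W m.length * T.fs W (m.length + 1) :=
    mul_le_mul (T.ns_le_fs W _ _) (T.ns_le_fs W _ _) (T.ns_nonneg _ _) (T.fs_nonneg _ _)
  have p2 : T.ns n.length (W b) * T.ns (n.length + 1) (W b)
      ≤ T.fs W n.length * T.fs W (n.length + 1) :=
    mul_le_mul (T.ns_le_fs W _ _) (T.ns_le_fs W _ _) (T.ns_nonneg _ _) (T.fs_nonneg _ _)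
  have h3 : 0 ≤ T.I (T.dl n (W b) ^ 4) := by
    rw [← e1]; exact T.I_nonneg _
  have q1 := mul_nonneg (T.fs_nonneg W m.length) (T.fs_nonneg W (m.length + 1))
  calc _ ≤ _ := h
    _ ≤ (9 * (T.fs W m.length * T.fs W (m.length + 1))) *
        (9 * (T.fs W n.length * T.fs W (n.length + 1))) :=
      mul_le_mul (by linarith) (by linarith) h3 (by linarith)
    _ = _ := by ring

/-- `‖∂^m f ∂^n g‖² ≤ 9 ‖∇^s W‖² ‖∇^{m+n+1-s} W‖²`. -/
theorem I_dl_mul_le (m n : List (Fin 2)) (a b : ι) (s r : ℕ) (hm : s ≤ m.length)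
    (hn : s ≤ n.length) (hr : m.length + n.length + 1 = s + r) :
    T.I ((T.dl m (W a) * T.dl n (W b)) * (T.dl m (W a) * T.dl n (W b))) ≤
      9 * (T.fs W s * T.fs W r) := by
  have h := T.I_dl_mul_sq_le hW m n a b
  have f0 := T.fs_nonneg W
  have lc := logConvex_mul_le f0 (T.fs_logConvex W) s
  have l1 := lc (m.length - s) (n.length + 1 - s)
  have l2 := lc (n.length - s) (m.length + 1 - s)
  rw [show s + (m.length - s) = m.length by omega,
    show s + (n.length + 1 - s) = n.length + 1 by omega,
    show m.length + (n.length + 1 - s) = r by omega] at l1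
  rw [show s + (n.length - s) = n.length by omega,
    show s + (m.length + 1 - s) = m.length + 1 by omega,
    show n.length + (m.length + 1 - s) = r by omega] at l2
  have := mul_le_mul l1 l2 (mul_nonneg (f0 _) (f0 _)) (mul_nonneg (f0 _) (f0 _))
  have q := mul_nonneg (f0 s) (f0 r)
  refine abs_le_of_sq_le_sq' ?_ (by linarith) |>.2
  nlinarith

theorem abs_I_trilinear_le (m n l : List (Fin 2)) (a b c : ι) (r : ℕ) (hm : 1 ≤ m.length)
    (hn : 1 ≤ n.length) (hr : m.length + n.length = r + 1) (hl : l.length = r) :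
    |T.I (T.dl m (W a) * T.dl n (W b) * T.dl l (W c))| ≤
      3 * √(T.fs W 1 * T.fs W r * T.fs W (r + 1)) := by
  have f0 := T.fs_nonneg W
  have bd : ∀ m, ∀ a, T.I (T.dl m (W a) * T.dl m (W a)) ≤ T.fs W m.length := fun m a =>
    (T.I_dl_sq_le_ns m (W a)).trans (T.ns_le_fs W _ _)
  have key : T.I (T.dl m (W a) * T.dl n (W b) * T.dl l (W c)) ^ 2 ≤
      9 * (T.fs W 1 * T.fs W r * T.fs W (r + 1)) := by
    subst hl
    have split : m.length = 1 ∨ n.length = 1 ∨ (2 ≤ m.length ∧ 2 ≤ n.length) := by omega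
    rcases split with h | h | h
    · have h1 := T.I_mul_sq_le (T.dl m (W a)) (T.dl n (W b) * T.dl l (W c))
      have h2 := bd m a
      have h3 := T.I_dl_mul_le hW n l b c l.length (l.length + 1) (by omega) le_rfl (by omega)
      rw [h] at h2
      rw [mul_assoc (T.dl m (W a))]
      refine h1.trans ((mul_le_mul h2 h3 (T.I_nonneg _) (f0 _)).trans_eq (by ring))
    · have h1 := T.I_mul_sq_le (T.dl n (W b)) (T.dl m (W a) * T.dl l (W c))
      have h2 := bd n b
      have h3 := T.I_dl_mul_le hW m l a c l.length (l.length + 1) (by omega) le_rfl (by omega)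
      rw [h] at h2
      rw [mul_comm (T.dl m (W a)), mul_assoc (T.dl n (W b))]
      refine h1.trans ((mul_le_mul h2 h3 (T.I_nonneg _) (f0 _)).trans_eq (by ring))
    · have h1 := T.I_mul_sq_le (T.dl m (W a) * T.dl n (W b)) (T.dl l (W c))
      have h2 := bd l c
      have h3 := T.I_dl_mul_le hW m n a b 1 (l.length + 1) (by omega) (by omega) (by omega)
      refine h1.trans ((mul_le_mul h3 h2 (T.I_nonneg _)
        (mul_nonneg (by norm_num) (mul_nonneg (f0 _) (f0 _)))).trans_eq (by ring))
  have q := mul_nonneg (mul_nonneg (f0 1) (f0 r)) (f0 (r + 1))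
  refine abs_le_of_sq_le_sq ?_ (by positivity)
  rw [mul_pow, Real.sq_sqrt q]
  linarith

end Family

/-- The Leibniz rule along a word, with the undifferentiated term split off. -/
theorem exists_leibniz (l : List (Fin 2)) : ∃ S : List (List (Fin 2) × List (Fin 2)),
    ((S.length : ℝ) = 2 ^ l.length - 1) ∧
    (∀ p ∈ S, 1 ≤ p.1.length ∧ p.1.length + p.2.length = l.length) ∧
    ∀ f g : A, T.dl l (f * g) =
      f * T.dl l g + (S.map fun p => T.dl p.1 f * T.dl p.2 g).sum := by
  induction l with
  | nil => exact ⟨[], by simp, by simp, fun f g => by simp [dl]⟩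
  | cons i l ih =>
    obtain ⟨S, h1, h2, h3⟩ := ih
    refine ⟨([i], l) :: (S.map (fun p => (i :: p.1, p.2)) ++ S.map (fun p => (p.1, i :: p.2))),
      ?_, ?_, ?_⟩
    · simp only [List.length_cons, List.length_append, List.length_map]
      push_cast
      rw [h1]; ring
    · intro p hp
      simp only [List.mem_cons, List.mem_append, List.mem_map] at hp
      rcases hp with rfl | ⟨q, hq, rfl⟩ | ⟨q, hq, rfl⟩
      · simp [add_comm]
      · have := h2 q hq
        simp only [List.length_cons]; omega
      · have := h2 q hq
        simp only [List.length_cons]; omega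
    · intro f g
      have h4 : ∀ S : List (List (Fin 2) × List (Fin 2)),
          T.D i (S.map fun p => T.dl p.1 f * T.dl p.2 g).sum =
          (S.map fun p => T.dl (i :: p.1) f * T.dl p.2 g).sum +
          (S.map fun p => T.dl p.1 f * T.dl (i :: p.2) g).sum := by
        intro S
        induction S with
        | nil => simp
        | cons p S ih =>
          simp only [List.map_cons, List.sum_cons, map_add, ih, Derivation.leibniz, smul_eq_mul, dl]
          ring
      simp only [dl] at h4 ⊢
      rw [h3, map_add, h4]
      simp only [Derivation.leibniz, smul_eq_mul, List.map_cons, List.sum_cons, List.map_append,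
        List.sum_append, List.map_map, Function.comp_def, dl]
      ring

theorem abs_I_list_sum_mul_le {β : Type*} (S : List β) (F : β → A) (x : A) (M : ℝ)
    (h : ∀ p ∈ S, |T.I (F p * x)| ≤ M) :
    |T.I ((S.map F).sum * x)| ≤ S.length * M := by
  induction S with
  | nil => simp
  | cons p S ih =>
    simp only [List.map_cons, List.sum_cons, add_mul, map_add, List.length_cons]
    have h1 := h p (by simp)
    have h2 := ih fun q hq => h q (by simp [hq])
    refine (abs_add_le _ _).trans ?_
    push_cast
    linarith

section Family

variable {ι : Type*} [Fintype ι] {W : ι → A} (hW : ∀ c, T.I (W c) = 0)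
include hW

theorem abs_I_commutator_le (l : List (Fin 2)) (a b c : ι) (j : Fin 2) :
    |T.I (T.dl l (W a * T.D j (W b)) * T.dl l (W c)) -
        T.I (W a * T.D j (T.dl l (W b)) * T.dl l (W c))| ≤
      (2 ^ l.length - 1) *
        (3 * √(T.fs W 1 * T.fs W l.length * T.fs W (l.length + 1))) := by
  obtain ⟨S, h1, h2, h3⟩ := T.exists_leibniz l
  rw [h3, add_mul, map_add, T.D_dl, add_sub_cancel_left, ← h1]
  refine T.abs_I_list_sum_mul_le S _ _ _ fun p hp => ?_
  have h4 := h2 p hp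
  have := T.abs_I_trilinear_le hW p.1 (j :: p.2) l a b c l.length h4.1 (by simp)
    (by simp only [List.length_cons]; omega) rfl
  simpa only [dl, T.D_dl] using this

theorem abs_I_dl_mul_mul_le (l : List (Fin 2)) (a b : ι) (x : A) :
    |T.I (T.dl l (W a * W b) * x)| ≤
      2 ^ l.length * (3 * √(T.fs W 0 * T.fs W (l.length + 1) * T.I (x * x))) := by
  have f0 := T.fs_nonneg W
  have q := mul_nonneg (mul_nonneg (f0 0) (f0 (l.length + 1))) (T.I_nonneg x)
  have key : ∀ m n : List (Fin 2), m.length + n.length = l.length →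
      |T.I (T.dl m (W a) * T.dl n (W b) * x)| ≤
        3 * √(T.fs W 0 * T.fs W (l.length + 1) * T.I (x * x)) := by
    intro m n hmn
    have h1 := T.I_mul_sq_le (T.dl m (W a) * T.dl n (W b)) x
    have h2 := T.I_dl_mul_le hW m n a b 0 (l.length + 1) (by simp) (by simp) (by omega)
    have h3 := mul_le_mul_of_nonneg_right h2 (T.I_nonneg x)
    refine abs_le_of_sq_le_sq ?_ (by positivity)
    rw [mul_pow, Real.sq_sqrt q]
    linarith
  obtain ⟨S, h1, h2, h3⟩ := T.exists_leibniz l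
  rw [h3, add_mul, map_add]
  have h4 := key [] l (by simp)
  have h5 := T.abs_I_list_sum_mul_le S (fun p => T.dl p.1 (W a) * T.dl p.2 (W b)) x _
    fun p hp => key p.1 p.2 (h2 p hp).2
  rw [h1] at h5
  simp only [dl] at h4
  refine (abs_add_le _ _).trans ?_
  linarith

end Family

/-- The MHD system at a fixed time, with `ut`, `bt` playing the role of the time derivatives. -/
structure MHDState (ν η : ℝ) (u b ut bt : Fin 2 → A) (p : A) : Prop where
  div_u : ∑ j, T.D j (u j) = 0
  div_b : ∑ j, T.D j (b j) = 0
  mean_u : ∀ i, T.I (u i) = 0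
  mean_b : ∀ i, T.I (b i) = 0
  eq_u : ∀ i, ut i + (∑ j, u j * T.D j (u i)) + T.D i p =
    ν • (∑ j, T.D j (T.D j (u i))) + ∑ j, b j * T.D j (b i)
  eq_b : ∀ i, bt i + (∑ j, u j * T.D j (b i)) =
    (∑ j, b j * T.D j (u i)) + η • ∑ j, T.D j (T.D j (b i))

/-- `‖∂^l w‖²`. -/
def en (l : List (Fin 2)) (w : Fin 2 → A) : ℝ := ∑ i, T.I (T.dl l (w i) * T.dl l (w i))

/-- `‖∇∂^l w‖²`. -/
def diss (l : List (Fin 2)) (w : Fin 2 → A) : ℝ :=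
  ∑ i, ∑ j, T.I (T.dl l (T.D j (w i)) * T.dl l (T.D j (w i)))

theorem en_nonneg (l : List (Fin 2)) (w : Fin 2 → A) : 0 ≤ T.en l w :=
  Finset.sum_nonneg fun _ _ => T.I_nonneg _

theorem diss_nonneg (l : List (Fin 2)) (w : Fin 2 → A) : 0 ≤ T.diss l w :=
  Finset.sum_nonneg fun _ _ => Finset.sum_nonneg fun _ _ => T.I_nonneg _

theorem en_le_diss (l : List (Fin 2)) (w : Fin 2 → A) (hw : ∀ i, T.I (w i) = 0) :
    T.en l w ≤ T.diss l w :=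
  Finset.sum_le_sum fun i _ => by
    simpa only [D_dl] using T.poincare _ (T.I_dl_eq_zero l _ (hw i))

/-- Pairing of `∂^l (v · ∇) w` with `∂^l z`. -/
def pair (l : List (Fin 2)) (v w z : Fin 2 → A) : ℝ :=
  ∑ i, ∑ j, T.I (T.dl l (v j * T.D j (w i)) * T.dl l (z i))

/-- Pairing of `(v · ∇) ∂^l w` with `∂^l z`. -/
def pair' (l : List (Fin 2)) (v w z : Fin 2 → A) : ℝ :=
  ∑ i, ∑ j, T.I (v j * T.D j (T.dl l (w i)) * T.dl l (z i))

theorem sum_I_transport (v : Fin 2 → A) (hv : ∑ j, T.D j (v j) = 0) (f g : A) :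
    ∑ j, T.I (v j * T.D j f * g) + ∑ j, T.I (v j * T.D j g * f) = 0 := by
  have h : ∀ j, T.I (v j * T.D j f * g) + T.I (v j * T.D j g * f) =
      -T.I (T.D j (v j) * (f * g)) := by
    intro j
    have h1 := T.I_mul_D j (v j) (f * g)
    rw [← h1, ← map_add, Derivation.leibniz]
    congr 1
    simp only [smul_eq_mul]; ring
  rw [← Finset.sum_add_distrib, Finset.sum_congr rfl fun j _ => h j, Finset.sum_neg_distrib,
    ← map_sum, ← Finset.sum_mul, hv, zero_mul, map_zero, neg_zero]

theorem pair'_add_swap (l : List (Fin 2)) (v w z : Fin 2 → A) (hv : ∑ j, T.D j (v j) = 0) :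
    T.pair' l v w z + T.pair' l v z w = 0 := by
  rw [pair', pair', ← Finset.sum_add_distrib]
  exact Finset.sum_eq_zero fun i _ => T.sum_I_transport v hv _ _

theorem sum_I_laplacian (l : List (Fin 2)) (a : A) :
    ∑ j, T.I (T.dl l (T.D j (T.D j a)) * T.dl l a) =
      -∑ j, T.I (T.dl l (T.D j a) * T.dl l (T.D j a)) := by
  rw [← Finset.sum_neg_distrib]
  refine Finset.sum_congr rfl fun j _ => ?_
  rw [← D_dl, mul_comm, I_mul_D, D_dl]

theorem sum_I_pressure (l : List (Fin 2)) (p : A) (u : Fin 2 → A) (hu : ∑ j, T.D j (u j) = 0) :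
    ∑ i, T.I (T.dl l (T.D i p) * T.dl l (u i)) = 0 := by
  have h : ∀ i, T.I (T.dl l (T.D i p) * T.dl l (u i)) = -T.I (T.dlₗ l (T.D i (u i)) * T.dl l p) := by
    intro i
    rw [← D_dl, mul_comm, I_mul_D, D_dl, dlₗ_apply]
  rw [Finset.sum_congr rfl fun j _ => h j, Finset.sum_neg_distrib,
    ← map_sum, ← Finset.sum_mul, ← map_sum, hu, map_zero, zero_mul, map_zero, neg_zero]

theorem I_dl_sum_mul (l : List (Fin 2)) (F : Fin 2 → A) (x : A) :
    T.I (T.dl l (∑ j, F j) * x) = ∑ j, T.I (T.dl l (F j) * x) := by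
  rw [← dlₗ_apply, map_sum, Finset.sum_mul, map_sum]
  rfl

variable {T}
variable {ν η : ℝ} {u b ut bt : Fin 2 → A} {p : A}

theorem MHDState.pairing_u (h : T.MHDState ν η u b ut bt p) (l : List (Fin 2)) :
    ∑ i, T.I (T.dl l (u i) * T.dl l (ut i)) =
      -ν * T.diss l u + T.pair l b b u - T.pair l u u u := by
  have h1 : ∀ i, T.I (T.dl l (u i) * T.dl l (ut i)) =
      -ν * (∑ j, T.I (T.dl l (T.D j (u i)) * T.dl l (T.D j (u i))))
      + ∑ j, T.I (T.dl l (b j * T.D j (b i)) * T.dl l (u i))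
      - ∑ j, T.I (T.dl l (u j * T.D j (u i)) * T.dl l (u i))
      - T.I (T.dl l (T.D i p) * T.dl l (u i)) := by
    intro i
    have h2 := congrArg (fun x => T.I (T.dl l x * T.dl l (u i))) (h.eq_u i)
    simp only [dl_add, dl_smul, add_mul, map_add, smul_mul_assoc, map_smul, I_dl_sum_mul,
      sum_I_laplacian, smul_eq_mul] at h2
    rw [mul_comm (T.dl l (u i))]
    linarith
  rw [Finset.sum_congr rfl fun i _ => h1 i]
  simp only [Finset.sum_sub_distrib, Finset.sum_add_distrib, ← Finset.mul_sum,
    T.sum_I_pressure l p u h.div_u, sub_zero]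
  rfl

theorem MHDState.pairing_b (h : T.MHDState ν η u b ut bt p) (l : List (Fin 2)) :
    ∑ i, T.I (T.dl l (b i) * T.dl l (bt i)) =
      -η * T.diss l b + T.pair l b u b - T.pair l u b b := by
  have h1 : ∀ i, T.I (T.dl l (b i) * T.dl l (bt i)) =
      -η * (∑ j, T.I (T.dl l (T.D j (b i)) * T.dl l (T.D j (b i))))
      + ∑ j, T.I (T.dl l (b j * T.D j (u i)) * T.dl l (b i))
      - ∑ j, T.I (T.dl l (u j * T.D j (b i)) * T.dl l (b i)) := by
    intro i
    have h2 := congrArg (fun x => T.I (T.dl l x * T.dl l (b i))) (h.eq_b i)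
    simp only [dl_add, dl_smul, add_mul, map_add, smul_mul_assoc, map_smul, I_dl_sum_mul,
      sum_I_laplacian, smul_eq_mul] at h2
    rw [mul_comm (T.dl l (b i))]
    linarith
  rw [Finset.sum_congr rfl fun i _ => h1 i]
  simp only [Finset.sum_sub_distrib, Finset.sum_add_distrib, ← Finset.mul_sum]
  rfl

theorem abs_pair_sub_pair'_le {ι : Type*} [Fintype ι] {W : ι → A} (hW : ∀ c, T.I (W c) = 0)
    (l : List (Fin 2)) (v w z : Fin 2 → ι) :
    |T.pair l (W ∘ v) (W ∘ w) (W ∘ z) - T.pair' l (W ∘ v) (W ∘ w) (W ∘ z)| ≤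
      12 * (2 ^ l.length - 1) * √(T.fs W 1 * T.fs W l.length * T.fs W (l.length + 1)) := by
  have h := fun i j => T.abs_I_commutator_le hW l (v j) (w i) (z i) j
  simp only [pair, pair', ← Finset.sum_sub_distrib]
  refine (Finset.abs_sum_le_sum_abs _ _).trans ((Finset.sum_le_sum fun i _ =>
    (Finset.abs_sum_le_sum_abs _ _).trans (Finset.sum_le_sum fun j _ => h i j)).trans_eq ?_)
  simp only [Finset.sum_const, Finset.card_univ, Fintype.card_fin, nsmul_eq_mul]
  push_cast; ring

theorem MHDState.mean_elim (h : T.MHDState ν η u b ut bt p) (c : Fin 2 ⊕ Fin 2) :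
    T.I (Sum.elim u b c) = 0 := by
  cases c with
  | inl i => exact h.mean_u i
  | inr i => exact h.mean_b i

/-- Energy estimate for the pair `(u, b)`. -/
theorem MHDState.energy_le (h : T.MHDState ν η u b ut bt p) (l : List (Fin 2)) :
    2 * ((∑ i, T.I (T.dl l (u i) * T.dl l (ut i))) + ∑ i, T.I (T.dl l (b i) * T.dl l (bt i))) ≤
      -2 * ν * T.diss l u - 2 * η * T.diss l b + 96 * (2 ^ l.length - 1) *
        √(T.fs (Sum.elim u b) 1 * T.fs (Sum.elim u b) l.length *
          T.fs (Sum.elim u b) (l.length + 1)) := by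
  rw [h.pairing_u, h.pairing_b]
  have k := fun v w z => abs_le.1 (abs_pair_sub_pair'_le h.mean_elim l v w z)
  have k1 := k Sum.inl Sum.inl Sum.inl
  have k2 := k Sum.inl Sum.inr Sum.inr
  have k3 := k Sum.inr Sum.inr Sum.inl
  have k4 := k Sum.inr Sum.inl Sum.inr
  simp only [Sum.elim_comp_inl, Sum.elim_comp_inr] at k1 k2 k3 k4
  have e1 := T.pair'_add_swap l u u u h.div_u
  have e2 := T.pair'_add_swap l u b b h.div_u
  have e3 := T.pair'_add_swap l b b u h.div_b
  linarith [k1.1, k2.1, k3.2, k4.2]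

theorem sum_mul_D_eq (v : Fin 2 → A) (hv : ∑ j, T.D j (v j) = 0) (f : A) :
    ∑ j, v j * T.D j f = ∑ j, T.D j (v j * f) := by
  simp only [Derivation.leibniz, smul_eq_mul, Finset.sum_add_distrib]
  rw [← Finset.mul_sum, hv, mul_zero, add_zero]

theorem abs_pair_div_le {ι : Type*} [Fintype ι] {W : Fin 2 → A} (hW : ∀ c, T.I (W c) = 0)
    (hv : ∑ j, T.D j (W j) = 0) (l : List (Fin 2)) (z : Fin 2 → A) :
    |T.pair l W W z| ≤ 12 * 2 ^ l.length *
      √(T.fs W 0 * T.fs W (l.length + 1) * T.diss l z) := by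
  have e : T.pair l W W z = ∑ i, ∑ j, -T.I (T.dl l (W j * W i) * T.dl l (T.D j (z i))) := by
    refine Finset.sum_congr rfl fun i _ => ?_
    rw [← I_dl_sum_mul, sum_mul_D_eq W hv, I_dl_sum_mul]
    refine Finset.sum_congr rfl fun j _ => ?_
    rw [← D_dl, mul_comm, I_mul_D, D_dl, mul_comm]
  have f0 := T.fs_nonneg W
  have h : ∀ i j, |-T.I (T.dl l (W j * W i) * T.dl l (T.D j (z i)))| ≤
      2 ^ l.length * (3 * √(T.fs W 0 * T.fs W (l.length + 1) * T.diss l z)) := by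
    intro i j
    rw [abs_neg]
    refine (T.abs_I_dl_mul_mul_le hW l j i _).trans ?_
    have : T.I (T.dl l (T.D j (z i)) * T.dl l (T.D j (z i))) ≤ T.diss l z :=
      (Finset.single_le_sum (f := fun j => T.I (T.dl l (T.D j (z i)) * T.dl l (T.D j (z i))))
        (fun _ _ => T.I_nonneg _) (Finset.mem_univ j)).trans
      (Finset.single_le_sum
        (f := fun i => ∑ j, T.I (T.dl l (T.D j (z i)) * T.dl l (T.D j (z i))))
        (fun _ _ => Finset.sum_nonneg fun _ _ => T.I_nonneg _) (Finset.mem_univ i))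
    have := mul_le_mul_of_nonneg_left this (mul_nonneg (f0 0) (f0 (l.length + 1)))
    gcongr
  rw [e]
  refine (Finset.abs_sum_le_sum_abs _ _).trans ((Finset.sum_le_sum fun i _ =>
    (Finset.abs_sum_le_sum_abs _ _).trans (Finset.sum_le_sum fun j _ => h i j)).trans_eq ?_)
  simp only [Finset.sum_const, Finset.card_univ, Fintype.card_fin, nsmul_eq_mul]
  push_cast; ring

/-- Energy estimate for `u` alone. -/
theorem MHDState.energy_u_le (h : T.MHDState ν η u b ut bt p) (l : List (Fin 2)) :
    2 * (∑ i, T.I (T.dl l (u i) * T.dl l (ut i))) ≤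
      -2 * ν * T.diss l u +
      24 * 2 ^ l.length * √(T.fs u 1 * T.fs u l.length * T.fs u (l.length + 1)) +
      24 * 2 ^ l.length * √(T.fs b 0 * T.fs b (l.length + 1) * T.diss l u) := by
  rw [h.pairing_u]
  have k1 := abs_le.1 (abs_pair_sub_pair'_le h.mean_u l id id id)
  have k2 := abs_le.1 (abs_pair_div_le (ι := Fin 2) h.mean_b h.div_b l u)
  simp only [Function.comp_id] at k1
  have e1 := T.pair'_add_swap l u u u h.div_u
  have := Real.sqrt_nonneg (T.fs u 1 * T.fs u l.length * T.fs u (l.length + 1))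
  linarith [k1.1, k2.2]


section MultiIndex

theorem dl_perm {l l' : List (Fin 2)} (h : l.Perm l') (a : A) : T.dl l a = T.dl l' a := by
  induction h with
  | nil => rfl
  | cons i _ ih => simp only [dl, ih]
  | swap i j l => simp only [dl]; rw [T.comm]
  | trans _ _ ih1 ih2 => rw [ih1, ih2]

variable {κ : Type*} {Φ : Finset κ} {word : κ → List (Fin 2)} {r : ℕ}

theorem ns_dl_le (hc : ∀ l : List (Fin 2), l.length = r → ∃ α ∈ Φ, (word α).Perm l) (a : A)
    (j : ℕ) (l : List (Fin 2)) (hl : l.length + j = r) :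
    T.ns j (T.dl l a) ≤ 2 ^ j * ∑ α ∈ Φ, T.I (T.dl (word α) a * T.dl (word α) a) := by
  induction j generalizing l with
  | zero =>
    obtain ⟨α, hα, hp⟩ := hc l (by simpa using hl)
    simp only [ns, pow_zero, one_mul, ← dl_perm hp]
    exact Finset.single_le_sum (f := fun α => T.I (T.dl (word α) a * T.dl (word α) a))
      (fun _ _ => T.I_nonneg _) hα
  | succ j ih =>
    simp only [ns, Fin.sum_univ_two]
    have h0 := ih (0 :: l) (by simp only [List.length_cons]; omega)
    have h1 := ih (1 :: l) (by simp only [List.length_cons]; omega)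
    simp only [dl] at h0 h1
    rw [pow_succ]; linarith

theorem ns_le (hc : ∀ l : List (Fin 2), l.length = r → ∃ α ∈ Φ, (word α).Perm l) (a : A) :
    T.ns r a ≤ 2 ^ r * ∑ α ∈ Φ, T.I (T.dl (word α) a * T.dl (word α) a) :=
  ns_dl_le hc a r [] (by simp)

variable (T) (Φ) (word) in
/-- Sum of `en` over a set of words. -/
def enS (w : Fin 2 → A) : ℝ := ∑ α ∈ Φ, T.en (word α) w

variable (T) (Φ) (word) in
/-- Sum of `diss` over a set of words. -/
def dissS (w : Fin 2 → A) : ℝ := ∑ α ∈ Φ, T.diss (word α) w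

theorem enS_nonneg (w : Fin 2 → A) : 0 ≤ T.enS Φ word w :=
  Finset.sum_nonneg fun _ _ => T.en_nonneg _ _

theorem dissS_nonneg (w : Fin 2 → A) : 0 ≤ T.dissS Φ word w :=
  Finset.sum_nonneg fun _ _ => T.diss_nonneg _ _

theorem enS_le_dissS (w : Fin 2 → A) (hw : ∀ i, T.I (w i) = 0) :
    T.enS Φ word w ≤ T.dissS Φ word w :=
  Finset.sum_le_sum fun α _ => T.en_le_diss (word α) w hw

theorem fs_le_enS (hc : ∀ l : List (Fin 2), l.length = r → ∃ α ∈ Φ, (word α).Perm l)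
    (w : Fin 2 → A) : T.fs w r ≤ 2 ^ r * T.enS Φ word w := by
  simp only [enS, en, fs]
  rw [Finset.sum_comm, Finset.mul_sum]
  exact Finset.sum_le_sum fun i _ => ns_le hc _

theorem fs_succ_le_dissS (hc : ∀ l : List (Fin 2), l.length = r → ∃ α ∈ Φ, (word α).Perm l)
    (w : Fin 2 → A) : T.fs w (r + 1) ≤ 2 ^ r * T.dissS Φ word w := by
  have h : T.dissS Φ word w = ∑ i, ∑ j, ∑ α ∈ Φ,
      T.I (T.dl (word α) (T.D j (w i)) * T.dl (word α) (T.D j (w i))) := by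
    simp only [dissS, diss]
    rw [Finset.sum_comm]
    exact Finset.sum_congr rfl fun i _ => Finset.sum_comm
  simp only [h, fs, ns, Finset.mul_sum (s := Finset.univ)]
  exact Finset.sum_le_sum fun i _ => Finset.sum_le_sum fun j _ => ns_le hc _

theorem fs_elim (u b : Fin 2 → A) (k : ℕ) :
    T.fs (Sum.elim u b) k = T.fs u k + T.fs b k := by
  simp [fs]

theorem mul_sqrt_le_young {K x y e : ℝ} (hx : 0 ≤ x) (hy : 0 ≤ y) (he : 0 < e) :
    K * √(x * y) ≤ e / 2 * y + K ^ 2 / (2 * e) * x := by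
  rw [Real.sqrt_mul hx]
  have h := sq_nonneg (e * √y - K * √x)
  have h1 := Real.sq_sqrt hx
  have h2 := Real.sq_sqrt hy
  have h3 : e / 2 * y + K ^ 2 / (2 * e) * x - K * (√x * √y) =
      (e * √y - K * √x) ^ 2 / (2 * e) := by
    rw [eq_div_iff (by positivity)]
    nth_rewrite 1 [← h1]
    nth_rewrite 1 [← h2]
    field_simp
    ring
  have h4 : 0 ≤ (e * √y - K * √x) ^ 2 / (2 * e) := by positivity
  linarith

theorem MHDState.basic_energy_le (h : T.MHDState ν η u b ut bt p) (hν : η ≤ ν) :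
    2 * ((∑ i, T.I (u i * ut i)) + ∑ i, T.I (b i * bt i)) ≤
      -2 * η * T.fs (Sum.elim u b) 1 := by
  have h1 := h.energy_le []
  have h2 : T.fs (Sum.elim u b) 1 = T.diss [] u + T.diss [] b := by
    rw [fs_elim]; rfl
  simp only [dl, List.length_nil, pow_zero, sub_self, mul_zero, zero_mul, add_zero] at h1
  rw [h2]
  have := mul_le_mul_of_nonneg_right hν (T.diss_nonneg [] u)
  linarith

/-- The constant in the energy estimates of order `r`. -/
def energyConst (r : ℕ) : ℝ := 96 * (r + 1) * 4 ^ r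

theorem MHDState.total_energy_le (h : T.MHDState ν η u b ut bt p) (hη : 0 < η) (hν : η ≤ ν)
    (hc : ∀ l : List (Fin 2), l.length = r → ∃ α ∈ Φ, (word α).Perm l)
    (hlen : ∀ α ∈ Φ, (word α).length = r) (hcard : Φ.card ≤ r + 1) :
    ∑ α ∈ Φ, 2 * ((∑ i, T.I (T.dl (word α) (u i) * T.dl (word α) (ut i))) +
        ∑ i, T.I (T.dl (word α) (b i) * T.dl (word α) (bt i))) ≤
      -(3 / 2) * η * (T.dissS Φ word u + T.dissS Φ word b) +
      energyConst r ^ 2 / (2 * η) * (T.fs (Sum.elim u b) 1 *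
        (T.enS Φ word u + T.enS Φ word b)) := by
  set s := T.fs (Sum.elim u b)
  have s0 : ∀ k, 0 ≤ s k := T.fs_nonneg _
  set E := T.enS Φ word u + T.enS Φ word b with hE
  set D := T.dissS Φ word u + T.dissS Φ word b with hD
  have E0 : 0 ≤ E := add_nonneg (enS_nonneg _) (enS_nonneg _)
  have D0 : 0 ≤ D := add_nonneg (dissS_nonneg _) (dissS_nonneg _)
  have h1 : s r ≤ 2 ^ r * E := by
    simp only [s]
    rw [fs_elim, mul_add]
    exact add_le_add (fs_le_enS hc u) (fs_le_enS hc b)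
  have h2 : s (r + 1) ≤ 2 ^ r * D := by
    simp only [s]
    rw [fs_elim, mul_add]
    exact add_le_add (fs_succ_le_dissS hc u) (fs_succ_le_dissS hc b)
  have h3 : √(s 1 * s r * s (r + 1)) ≤ 2 ^ r * √(s 1 * E * D) := by
    have : (2 : ℝ) ^ r * √(s 1 * E * D) = √((2 ^ r) ^ 2 * (s 1 * E * D)) := by
      rw [Real.sqrt_mul (sq_nonneg _), Real.sqrt_sq (by positivity)]
    rw [this]
    refine Real.sqrt_le_sqrt ?_
    calc s 1 * s r * s (r + 1) ≤ s 1 * (2 ^ r * E) * (2 ^ r * D) :=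
          mul_le_mul (mul_le_mul_of_nonneg_left h1 (s0 1)) h2 (s0 _)
            (mul_nonneg (s0 1) (by positivity))
      _ = _ := by ring
  have h4 : ∀ α ∈ Φ, 2 * ((∑ i, T.I (T.dl (word α) (u i) * T.dl (word α) (ut i))) +
        ∑ i, T.I (T.dl (word α) (b i) * T.dl (word α) (bt i))) ≤
      (-2 * η * T.diss (word α) u - 2 * η * T.diss (word α) b) +
        96 * 4 ^ r * √(s 1 * E * D) := by
    intro α hα
    have h5 := h.energy_le (word α)
    rw [hlen α hα] at h5
    have h6 := mul_le_mul_of_nonneg_right hν (T.diss_nonneg (word α) u)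
    have h7 : (2 ^ r - 1) * √(s 1 * s r * s (r + 1)) ≤ 4 ^ r * √(s 1 * E * D) := by
      calc (2 ^ r - 1) * √(s 1 * s r * s (r + 1)) ≤ 2 ^ r * (2 ^ r * √(s 1 * E * D)) :=
            mul_le_mul (by linarith) h3 (by positivity) (by positivity)
        _ = _ := by
            rw [← mul_assoc, ← mul_pow]; norm_num
    linarith
  refine (Finset.sum_le_sum h4).trans ?_
  have hcard' : (Φ.card : ℝ) ≤ r + 1 := by exact_mod_cast hcard
  have h8 := mul_sqrt_le_young (K := energyConst r) (mul_nonneg (s0 1) E0) D0 hη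
  have h9 : (Φ.card : ℝ) * (96 * 4 ^ r * √(s 1 * E * D)) ≤ energyConst r * √(s 1 * E * D) := by
    rw [energyConst]
    calc _ ≤ ((r : ℝ) + 1) * (96 * 4 ^ r * √(s 1 * E * D)) := by gcongr
      _ = _ := by ring
  simp only [Finset.sum_add_distrib, Finset.sum_sub_distrib, ← Finset.mul_sum, Finset.sum_const,
    nsmul_eq_mul]
  change -2 * η * T.dissS Φ word u - 2 * η * T.dissS Φ word b + _ ≤ _
  have : -2 * η * T.dissS Φ word u - 2 * η * T.dissS Φ word b = -2 * η * D := by rw [hD]; ring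
  linarith

theorem MHDState.total_energy_u_le (h : T.MHDState ν η u b ut bt p) (hη : 0 < η) (hν : η ≤ ν)
    (hc : ∀ l : List (Fin 2), l.length = r → ∃ α ∈ Φ, (word α).Perm l)
    (hlen : ∀ α ∈ Φ, (word α).length = r) (hcard : Φ.card ≤ r + 1) :
    ∑ α ∈ Φ, 2 * (∑ i, T.I (T.dl (word α) (u i) * T.dl (word α) (ut i))) ≤
      -ν * T.dissS Φ word u +
      energyConst r ^ 2 / (2 * η) * (T.fs (Sum.elim u b) 1 * T.enS Φ word u) +
      energyConst r ^ 2 / (2 * ν) * ((T.en [] u + T.en [] b) *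
        (T.dissS Φ word u + T.dissS Φ word b)) := by
  have hν0 : 0 < ν := hη.trans_le hν
  have a0 : ∀ k, 0 ≤ T.fs u k := T.fs_nonneg _
  have b0 : ∀ k, 0 ≤ T.fs b k := T.fs_nonneg _
  set E := T.enS Φ word u with hE
  set D := T.dissS Φ word u with hD
  set B := T.dissS Φ word b with hB
  have E0 : 0 ≤ E := enS_nonneg _
  have D0 : 0 ≤ D := dissS_nonneg _
  have B0 : 0 ≤ B := dissS_nonneg _
  have h1 : T.fs u r ≤ 2 ^ r * E := fs_le_enS hc u
  have h2 : T.fs u (r + 1) ≤ 2 ^ r * D := fs_succ_le_dissS hc u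
  have h2' : T.fs b (r + 1) ≤ 2 ^ r * B := fs_succ_le_dissS hc b
  have pull : ∀ x, (2 : ℝ) ^ r * √x = √((2 ^ r) ^ 2 * x) := by
    intro x
    rw [Real.sqrt_mul (sq_nonneg _), Real.sqrt_sq (by positivity)]
  have h3 : √(T.fs u 1 * T.fs u r * T.fs u (r + 1)) ≤ 2 ^ r * √(T.fs u 1 * E * D) := by
    rw [pull]
    refine Real.sqrt_le_sqrt ?_
    calc T.fs u 1 * T.fs u r * T.fs u (r + 1) ≤ T.fs u 1 * (2 ^ r * E) * (2 ^ r * D) :=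
          mul_le_mul (mul_le_mul_of_nonneg_left h1 (a0 1)) h2 (a0 _)
            (mul_nonneg (a0 1) (by positivity))
      _ = _ := by ring
  have h3' : ∀ α ∈ Φ, √(T.fs b 0 * T.fs b (r + 1) * T.diss (word α) u) ≤
      2 ^ r * √(T.fs b 0 * B * D) := by
    intro α hα
    have h5 : T.diss (word α) u ≤ D :=
      Finset.single_le_sum (f := fun α => T.diss (word α) u) (fun _ _ => T.diss_nonneg _ _) hα
    rw [pull]
    refine Real.sqrt_le_sqrt ?_
    have h6 : (1 : ℝ) ≤ 2 ^ r := one_le_pow₀ (by norm_num)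
    calc T.fs b 0 * T.fs b (r + 1) * T.diss (word α) u ≤ T.fs b 0 * (2 ^ r * B) * (2 ^ r * D) :=
          mul_le_mul (mul_le_mul_of_nonneg_left h2' (b0 0))
            (h5.trans (le_mul_of_one_le_left D0 h6)) (T.diss_nonneg _ _)
            (mul_nonneg (b0 0) (by positivity))
      _ = _ := by ring
  have four : (2 : ℝ) ^ r * 2 ^ r = 4 ^ r := by rw [← mul_pow]; norm_num
  have h4 : ∀ α ∈ Φ, 2 * (∑ i, T.I (T.dl (word α) (u i) * T.dl (word α) (ut i))) ≤
      -2 * ν * T.diss (word α) u + 24 * 4 ^ r * √(T.fs u 1 * E * D) +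
        24 * 4 ^ r * √(T.fs b 0 * B * D) := by
    intro α hα
    have h5 := h.energy_u_le (word α)
    rw [hlen α hα] at h5
    refine h5.trans ?_
    have k1 := mul_le_mul_of_nonneg_left h3 (show (0 : ℝ) ≤ 24 * 2 ^ r by positivity)
    have k2 := mul_le_mul_of_nonneg_left (h3' α hα) (show (0 : ℝ) ≤ 24 * 2 ^ r by positivity)
    rw [← four]
    linarith
  refine (Finset.sum_le_sum h4).trans ?_
  have hcard' : (Φ.card : ℝ) ≤ r + 1 := by exact_mod_cast hcard
  have h8 := mul_sqrt_le_young (K := energyConst r) (mul_nonneg (a0 1) E0) D0 hν0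
  have h8' := mul_sqrt_le_young (K := energyConst r) (mul_nonneg (b0 0) B0) D0 hν0
  have h9 : ∀ x, (Φ.card : ℝ) * (24 * 4 ^ r * √x) ≤ energyConst r * √x := by
    intro x
    rw [energyConst]
    calc _ ≤ ((r : ℝ) + 1) * (96 * 4 ^ r * √x) := by gcongr; norm_num
      _ = _ := by ring
  simp only [Finset.sum_add_distrib, ← Finset.mul_sum, Finset.sum_const, nsmul_eq_mul]
  change -2 * ν * D + _ + _ ≤ _
  have g1 : energyConst r ^ 2 / (2 * ν) * (T.fs u 1 * E) ≤
      energyConst r ^ 2 / (2 * η) * (T.fs (Sum.elim u b) 1 * E) := by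
    have : T.fs u 1 ≤ T.fs (Sum.elim u b) 1 := by rw [fs_elim]; linarith [b0 1]
    gcongr
    exact mul_nonneg (a0 1) E0
  have g2 : energyConst r ^ 2 / (2 * ν) * (T.fs b 0 * B) ≤
      energyConst r ^ 2 / (2 * ν) * ((T.en [] u + T.en [] b) * (D + B)) := by
    have e : T.fs b 0 = T.en [] b := rfl
    have := T.en_nonneg [] u
    have := T.en_nonneg [] b
    rw [e]
    gcongr <;> linarith
  linarith [h9 (T.fs u 1 * E * D), h9 (T.fs b 0 * B * D)]

end MultiIndex

end TorusCalculus


theorem antitoneOn_Ici_of_hasDerivAt {f f' : ℝ → ℝ} (hc : ContinuousOn f (Ici 0))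
    (hd : ∀ t, 0 < t → HasDerivAt f (f' t) t) (hf : ∀ t, 0 < t → f' t ≤ 0) :
    AntitoneOn f (Ici 0) := by
  refine antitoneOn_of_deriv_nonpos (convex_Ici 0) hc ?_ ?_
  · intro t ht
    rw [interior_Ici] at ht
    exact (hd t ht).differentiableAt.differentiableWithinAt
  · intro t ht
    rw [interior_Ici] at ht
    rw [(hd t ht).deriv]
    exact hf t ht

/-- The Gronwall argument: `G` is the basic energy, `E` the energy of `(u, b)` of order `r` and
`U` that of `u`. -/
theorem decay_of_differential_inequalities {ν η K : ℝ} (hη : 0 < η) (hν : η ≤ ν)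
    {G E U G' E' U' s D V : ℝ → ℝ}
    (cG : ContinuousOn G (Ici 0)) (cE : ContinuousOn E (Ici 0)) (cU : ContinuousOn U (Ici 0))
    (dG : ∀ t, 0 < t → HasDerivAt G (G' t) t) (dE : ∀ t, 0 < t → HasDerivAt E (E' t) t)
    (dU : ∀ t, 0 < t → HasDerivAt U (U' t) t)
    (G0 : ∀ t, 0 ≤ t → 0 ≤ G t) (U0 : ∀ t, 0 ≤ t → 0 ≤ U t) (E0 : ∀ t, 0 ≤ t → 0 ≤ E t)
    (ED : ∀ t, 0 < t → E t ≤ D t) (UV : ∀ t, 0 < t → U t ≤ V t)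
    (s0 : ∀ t, 0 < t → 0 ≤ s t)
    (hG : ∀ t, 0 < t → G' t ≤ -2 * η * s t)
    (hE : ∀ t, 0 < t → E' t ≤ -(3 / 2) * η * D t + K ^ 2 / (2 * η) * (s t * E t))
    (hU : ∀ t, 0 < t → U' t ≤ -ν * V t + K ^ 2 / (2 * η) * (s t * U t) +
      K ^ 2 / (2 * ν) * (G t * D t)) {t : ℝ} (ht : 0 ≤ t) :
    U t ≤ (U 0 + K ^ 2 * G 0 * exp (K ^ 2 / (4 * η ^ 2) * G 0) / (ν * η) *
      exp ((ν - η) * t) * E 0) * exp (K ^ 2 / (4 * η ^ 2) * G 0) * exp (-ν * t) := by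
  have hν0 : 0 < ν := hη.trans_le hν
  set c := K ^ 2 / (4 * η ^ 2) with hc
  have c0 : 0 ≤ c := by positivity
  have hcη : c * (2 * η) = K ^ 2 / (2 * η) := by rw [hc]; field_simp; norm_num
  have Gmono : AntitoneOn G (Ici 0) := antitoneOn_Ici_of_hasDerivAt cG dG fun t ht => by
    have := hG t ht
    have := mul_nonneg hη.le (s0 t ht)
    linarith
  have GG : ∀ t, 0 ≤ t → G t ≤ G 0 := fun t ht => Gmono self_mem_Ici ht ht
  have mon : ∀ t, 0 < t → c * G' t ≤ -(K ^ 2 / (2 * η)) * s t := by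
    intro t ht
    have := mul_le_mul_of_nonneg_left (hG t ht) c0
    rw [← hcη]; linarith
  -- the weighted energy of `(u, b)`
  have cexp : ContinuousOn (fun t => exp (c * G t)) (Ici 0) :=
    Real.continuous_exp.comp_continuousOn (continuousOn_const.mul cG)
  have dexp : ∀ t, 0 < t → HasDerivAt (fun t => exp (c * G t))
      (exp (c * G t) * (c * G' t)) t := fun t ht => ((dG t ht).const_mul c).exp
  have dlin : ∀ a t : ℝ, HasDerivAt (fun t => exp (a * t)) (exp (a * t) * a) t := by
    intro a t
    simpa using ((hasDerivAt_id t).const_mul a).exp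
  have clin : ∀ a : ℝ, Continuous (fun t => exp (a * t)) := fun a => by fun_prop
  set X : ℝ → ℝ := fun t => E t * exp (c * G t) * exp (η * t) with hX
  have cX : ContinuousOn X (Ici 0) := (cE.mul cexp).mul (clin η).continuousOn
  have dX : ∀ t, 0 < t → HasDerivAt X
      ((E' t * exp (c * G t) + E t * (exp (c * G t) * (c * G' t))) * exp (η * t) +
        E t * exp (c * G t) * (exp (η * t) * η)) t :=
    fun t ht => ((dE t ht).mul (dexp t ht)).mul (dlin η t)
  have bX : ∀ t, 0 < t → (E' t * exp (c * G t) + E t * (exp (c * G t) * (c * G' t))) *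
      exp (η * t) + E t * exp (c * G t) * (exp (η * t) * η) ≤ -(η / 2) * D t * exp (η * t) := by
    intro t ht
    have e1 : E' t + E t * (c * G' t) + η * E t ≤ -(η / 2) * D t := by
      have h1 := hE t ht
      have h2 := mul_le_mul_of_nonneg_left (mon t ht) (E0 t ht.le)
      have h3 := mul_le_mul_of_nonneg_left (ED t ht) hη.le
      linarith
    have D0 : 0 ≤ D t := (E0 t ht.le).trans (ED t ht)
    have e2 : 1 ≤ exp (c * G t) := Real.one_le_exp (mul_nonneg c0 (G0 t ht.le))
    have e3 : (E' t + E t * (c * G' t) + η * E t) * exp (c * G t) ≤ -(η / 2) * D t := by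
      have h1 := mul_le_mul_of_nonneg_right e1 (exp_pos (c * G t)).le
      have h2 := mul_le_mul_of_nonneg_left e2 (mul_nonneg hη.le D0)
      linarith
    have h1 := mul_le_mul_of_nonneg_right e3 (exp_pos (η * t)).le
    linarith
  have Xmono : AntitoneOn X (Ici 0) := antitoneOn_Ici_of_hasDerivAt cX dX fun t ht => by
    refine (bX t ht).trans ?_
    have D0 : 0 ≤ D t := (E0 t ht.le).trans (ED t ht)
    have : 0 ≤ η / 2 * D t * exp (η * t) := by positivity
    linarith
  set κ := K ^ 2 * G 0 * exp (c * G 0) / (ν * η) with hκ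
  have G00 := G0 0 le_rfl
  have κ0 : 0 ≤ κ := by positivity
  -- the Lyapunov functional
  set Z : ℝ → ℝ := fun t => U t * exp (c * G t) * exp (ν * t) +
    κ * (exp ((ν - η) * t) * (X t - X 0)) with hZ
  have cZ : ContinuousOn Z (Ici 0) := ((cU.mul cexp).mul (clin ν).continuousOn).add
    (continuousOn_const.mul ((clin _).continuousOn.mul (cX.sub continuousOn_const)))
  have Zmono : AntitoneOn Z (Ici 0) := by
    refine antitoneOn_Ici_of_hasDerivAt cZ (fun t ht =>
      (((dU t ht).mul (dexp t ht)).mul (dlin ν t)).add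
        (((dlin (ν - η) t).mul ((dX t ht).sub_const (X 0))).const_mul κ)) fun t ht => ?_
    have D0 : 0 ≤ D t := (E0 t ht.le).trans (ED t ht)
    have e1 : U' t + U t * (c * G' t) + ν * U t ≤ K ^ 2 / (2 * ν) * (G 0 * D t) := by
      have h1 := hU t ht
      have h2 := mul_le_mul_of_nonneg_left (mon t ht) (U0 t ht.le)
      have h3 := mul_le_mul_of_nonneg_left (UV t ht) hν0.le
      have h4 : K ^ 2 / (2 * ν) * (G t * D t) ≤ K ^ 2 / (2 * ν) * (G 0 * D t) := by
        have := GG t ht.le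
        gcongr
      linarith
    have e2 : exp (c * G t) ≤ exp (c * G 0) := by
      have := GG t ht.le
      gcongr
    have e3 : (U' t + U t * (c * G' t) + ν * U t) * exp (c * G t) ≤ κ * (η / 2) * D t := by
      calc _ ≤ K ^ 2 / (2 * ν) * (G 0 * D t) * exp (c * G t) := by gcongr
        _ ≤ K ^ 2 / (2 * ν) * (G 0 * D t) * exp (c * G 0) := by gcongr
        _ = _ := by rw [hκ]; field_simp
    have e4 := mul_le_mul_of_nonneg_right e3 (exp_pos (ν * t)).le
    have e5 : X t - X 0 ≤ 0 := sub_nonpos.2 (Xmono self_mem_Ici ht.le ht.le)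
    have e6 : exp ((ν - η) * t) * (ν - η) * (X t - X 0) ≤ 0 :=
      mul_nonpos_of_nonneg_of_nonpos (mul_nonneg (exp_pos _).le (by linarith)) e5
    have e7 : exp (ν * t) = exp ((ν - η) * t) * exp (η * t) := by
      rw [← exp_add]; congr 1; ring
    have e8 := mul_le_mul_of_nonneg_left (bX t ht) (exp_pos ((ν - η) * t)).le
    have e9 := mul_le_mul_of_nonneg_left (add_le_add e6 e8) κ0
    have e10 : κ * (0 + exp ((ν - η) * t) * (-(η / 2) * D t * exp (η * t))) =
        -(κ * (η / 2) * D t * exp (ν * t)) := by rw [e7]; ring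
    rw [e10] at e9
    simp only [Pi.mul_apply]
    linarith
  have fin := Zmono self_mem_Ici ht ht
  have hX0 : X 0 = E 0 * exp (c * G 0) := by simp [hX]
  have hXt : 0 ≤ X t := by
    have := E0 t ht
    positivity
  have fin' : U t * exp (c * G t) * exp (ν * t) ≤
      U 0 * exp (c * G 0) + κ * (exp ((ν - η) * t) * (E 0 * exp (c * G 0))) := by
    have h1 : Z 0 = U 0 * exp (c * G 0) := by simp [hZ]
    rw [h1] at fin
    simp only [hZ] at fin
    rw [hX0] at fin
    have : 0 ≤ κ * (exp ((ν - η) * t) * X t) := by positivity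
    linarith
  have e2 : 1 ≤ exp (c * G t) := Real.one_le_exp (mul_nonneg c0 (G0 t ht))
  have hUt := U0 t ht
  calc U t = U t * 1 * (exp (ν * t) * exp (-ν * t)) := by rw [← exp_add]; simp
    _ ≤ U t * exp (c * G t) * (exp (ν * t) * exp (-ν * t)) := by gcongr
    _ = U t * exp (c * G t) * exp (ν * t) * exp (-ν * t) := by ring
    _ ≤ (U 0 * exp (c * G 0) + κ * (exp ((ν - η) * t) * (E 0 * exp (c * G 0)))) *
        exp (-ν * t) := by gcongr
    _ = _ := by ring

theorem continuous_vec2 : Continuous fun p : ℝ × ℝ => ![p.1, p.2] := by fun_prop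

theorem isCompact_box (d : ℕ) (L : ℝ) : IsCompact (box d L) := isCompact_Icc

theorem integrableOn_box {f : (Fin 2 → ℝ) → ℝ} (hf : Continuous f) :
    IntegrableOn f (box 2 1) := hf.continuousOn.integrableOn_compact (isCompact_box 2 1)

theorem integral_box_eq_prod (f : (Fin 2 → ℝ) → ℝ) :
    ∫ x in box 2 1, f x = ∫ p in Icc (0 : ℝ) 1 ×ˢ Icc (0 : ℝ) 1, f ![p.1, p.2] := by
  have h := (MeasureTheory.volume_preserving_finTwoArrow ℝ).symm
  rw [← h.setIntegral_preimage_emb (MeasurableEquiv.measurableEmbedding _)]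
  have h2 : (MeasurableEquiv.finTwoArrow (α := ℝ)).symm ⁻¹' box 2 1 =
      Icc (0 : ℝ) 1 ×ˢ Icc (0 : ℝ) 1 := by
    ext p
    simp only [box, mem_preimage, mem_Icc, Pi.le_def, Fin.forall_fin_two, mem_prod]
    simp [MeasurableEquiv.finTwoArrow, MeasurableEquiv.piFinTwo]
    tauto
  rw [h2]
  rfl

theorem integral_box_eq {f : (Fin 2 → ℝ) → ℝ} (hf : Continuous f) :
    ∫ x in box 2 1, f x = ∫ x in (0 : ℝ)..1, ∫ y in (0 : ℝ)..1, f ![x, y] := by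
  rw [integral_box_eq_prod, Measure.volume_eq_prod, setIntegral_prod]
  · simp only [intervalIntegral.integral_of_le zero_le_one, integral_Icc_eq_integral_Ioc]
  · exact (hf.comp continuous_vec2).continuousOn.integrableOn_compact
      (isCompact_Icc.prod isCompact_Icc)

theorem integral_box_eq_swap {f : (Fin 2 → ℝ) → ℝ} (hf : Continuous f) :
    ∫ x in box 2 1, f x = ∫ y in (0 : ℝ)..1, ∫ x in (0 : ℝ)..1, f ![x, y] := by
  rw [integral_box_eq_prod, Measure.volume_eq_prod, ← setIntegral_prod_swap,
    setIntegral_prod]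
  · simp only [intervalIntegral.integral_of_le zero_le_one, integral_Icc_eq_integral_Ioc]
    rfl
  · exact (hf.comp (continuous_vec2.comp continuous_swap)).continuousOn.integrableOn_compact
      (isCompact_Icc.prod isCompact_Icc)

theorem integral_box_mono {f g : (Fin 2 → ℝ) → ℝ} (hf : Continuous f) (hg : Continuous g)
    (h : ∀ x ∈ Icc (0 : ℝ) 1, ∀ y ∈ Icc (0 : ℝ) 1, f ![x, y] ≤ g ![x, y]) :
    ∫ x in box 2 1, f x ≤ ∫ x in box 2 1, g x := by
  refine setIntegral_mono_on (integrableOn_box hf) (integrableOn_box hg)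
    (isCompact_box 2 1).measurableSet fun z hz => ?_
  have e : z = ![z 0, z 1] := by ext i; fin_cases i <;> rfl
  rw [e]
  exact h _ ⟨hz.1 0, hz.2 0⟩ _ ⟨hz.1 1, hz.2 1⟩

theorem integral_box_const (c : ℝ) : ∫ _ in box 2 1, c = c := by
  rw [integral_box_eq continuous_const]; simp

section OneDim

variable {q q' : ℝ → ℝ} (hq : ∀ s, HasDerivAt q (q' s) s) (hq' : Continuous q')
include hq hq'

theorem sub_le_integral_of_abs_deriv_le {w : ℝ → ℝ} (hw : Continuous w) (h : ∀ s, |q' s| ≤ w s)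
    {x y : ℝ} (hx : x ∈ Icc (0 : ℝ) 1) (hy : y ∈ Icc (0 : ℝ) 1) :
    q x - q y ≤ ∫ s in (0 : ℝ)..1, w s := by
  rw [← intervalIntegral.integral_eq_sub_of_hasDerivAt (fun s _ => hq s)
    (hq'.intervalIntegrable _ _)]
  have w0 : ∀ s, 0 ≤ w s := fun s => (abs_nonneg _).trans (h s)
  have key : ∀ {a b : ℝ}, a ∈ Icc (0 : ℝ) 1 → b ∈ Icc (0 : ℝ) 1 → a ≤ b →
      |∫ s in a..b, q' s| ≤ ∫ s in (0 : ℝ)..1, w s := by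
    intro a b ha hb hab
    refine (intervalIntegral.abs_integral_le_integral_abs hab).trans
      ((intervalIntegral.integral_mono_on hab (hq'.abs.intervalIntegrable _ _)
        (hw.intervalIntegrable _ _) fun s _ => h s).trans ?_)
    exact intervalIntegral.integral_mono_interval ha.1 hab hb.2
      (Filter.Eventually.of_forall w0) (hw.intervalIntegrable _ _)
  refine (le_abs_self _).trans ?_
  rcases le_total y x with hxy | hxy
  · exact key hy hx hxy
  · rw [intervalIntegral.integral_symm, abs_neg]
    exact key hx hy hxy

theorem le_integral_add {w : ℝ → ℝ} (hw : Continuous w) (h : ∀ s, |q' s| ≤ w s)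
    {x : ℝ} (hx : x ∈ Icc (0 : ℝ) 1) :
    q x ≤ ∫ s in (0 : ℝ)..1, (q s + w s) := by
  have qc : Continuous q := continuous_iff_continuousAt.2 fun s => (hq s).continuousAt
  have h1 : ∫ s in (0 : ℝ)..1, (q x - ∫ s in (0 : ℝ)..1, w s) ≤ ∫ s in (0 : ℝ)..1, q s := by
    refine intervalIntegral.integral_mono_on zero_le_one (by simp)
      (qc.intervalIntegrable _ _) fun s hs => ?_
    have := sub_le_integral_of_abs_deriv_le hq hq' hw h hx hs
    linarith
  rw [intervalIntegral.integral_add (qc.intervalIntegrable _ _) (hw.intervalIntegrable _ _)]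
  simp at h1
  linarith

theorem sq_sub_le_integral_of_le {x y : ℝ} (hx : x ∈ Icc (0 : ℝ) 1) (hy : y ∈ Icc (0 : ℝ) 1)
    (hxy : y ≤ x) : (q x - q y) ^ 2 ≤ ∫ s in (0 : ℝ)..1, q' s ^ 2 := by
  have c2 : Continuous fun s => q' s ^ 2 := hq'.pow 2
  set d := q x - q y with hd
  have e : ∫ s in y..x, q' s = d := intervalIntegral.integral_eq_sub_of_hasDerivAt
    (fun s _ => hq s) (hq'.intervalIntegrable _ _)
  have h1 : 0 ≤ ∫ s in y..x, (q' s ^ 2 - 2 * d * q' s + d ^ 2) :=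
    intervalIntegral.integral_nonneg hxy fun s _ => by nlinarith [sq_nonneg (q' s - d)]
  rw [intervalIntegral.integral_add ((by fun_prop : Continuous _).intervalIntegrable _ _) (by simp),
    intervalIntegral.integral_sub (c2.intervalIntegrable _ _)
      ((by fun_prop : Continuous _).intervalIntegrable _ _),
    intervalIntegral.integral_const_mul, e] at h1
  simp only [intervalIntegral.integral_const, smul_eq_mul] at h1
  have h2 : ∫ s in y..x, q' s ^ 2 ≤ ∫ s in (0 : ℝ)..1, q' s ^ 2 :=
    intervalIntegral.integral_mono_interval hy.1 hxy hx.2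
      (Filter.Eventually.of_forall fun s => sq_nonneg _) (c2.intervalIntegrable _ _)
  nlinarith [sq_nonneg d, hx.2, hy.1]

theorem sq_sub_le_integral {x y : ℝ} (hx : x ∈ Icc (0 : ℝ) 1) (hy : y ∈ Icc (0 : ℝ) 1) :
    (q x - q y) ^ 2 ≤ ∫ s in (0 : ℝ)..1, q' s ^ 2 := by
  rcases le_total y x with h | h
  · exact sq_sub_le_integral_of_le hq hq' hx hy h
  · rw [← neg_sub, neg_sq]
    exact sq_sub_le_integral_of_le hq hq' hy hx h

end OneDim

theorem pd_contDiff {f : (Fin 2 → ℝ) → ℝ} (hf : ContDiff ℝ (⊤ : ℕ∞) f) (i : Fin 2) :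
    ContDiff ℝ (⊤ : ℕ∞) (pd i f) :=
  (hf.fderiv_right (m := (⊤ : ℕ∞)) (by simp)).clm_apply contDiff_const

theorem hasDerivAt_update_slice {f : (Fin 2 → ℝ) → ℝ} (hf : ContDiff ℝ (⊤ : ℕ∞) f) (i : Fin 2)
    (z : Fin 2 → ℝ) (s : ℝ) :
    HasDerivAt (fun s => f (Function.update z i s)) (pd i f (Function.update z i s)) s :=
  ((hf.differentiable (by simp)) _).hasFDerivAt.comp_hasDerivAt s (hasDerivAt_update z i s)

theorem update_vec_zero (x y s : ℝ) : Function.update ![x, y] 0 s = ![s, y] := by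
  ext i; fin_cases i <;> simp

theorem update_vec_one (x y s : ℝ) : Function.update ![x, y] 1 s = ![x, s] := by
  ext i; fin_cases i <;> simp

theorem hasDerivAt_slice_zero {f : (Fin 2 → ℝ) → ℝ} (hf : ContDiff ℝ (⊤ : ℕ∞) f) (y s : ℝ) :
    HasDerivAt (fun s => f ![s, y]) (pd 0 f ![s, y]) s := by
  have h := hasDerivAt_update_slice hf 0 ![0, y] s
  simpa only [update_vec_zero] using h

theorem hasDerivAt_slice_one {f : (Fin 2 → ℝ) → ℝ} (hf : ContDiff ℝ (⊤ : ℕ∞) f) (x s : ℝ) :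
    HasDerivAt (fun s => f ![x, s]) (pd 1 f ![x, s]) s := by
  have h := hasDerivAt_update_slice hf 1 ![x, 0] s
  simpa only [update_vec_one] using h

theorem pd_prdc {f : (Fin 2 → ℝ) → ℝ} (hf : Prdc 1 f) (i : Fin 2) :
    Prdc 1 (pd i f) := by
  intro x j
  have h : (fun y => f (y + Pi.single j 1)) = f := funext fun y => hf y j
  have := fderiv_comp_add_right (𝕜 := ℝ) (f := f) (x := x) (Pi.single j 1)
  rw [h] at this
  simp only [pd, this]

theorem pd_comm {f : (Fin 2 → ℝ) → ℝ} (hf : ContDiff ℝ (⊤ : ℕ∞) f) (i j : Fin 2) :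
    pd i (pd j f) = pd j (pd i f) := by
  have hd : Differentiable ℝ (fderiv ℝ f) :=
    (hf.fderiv_right (m := (⊤ : ℕ∞)) (by simp)).differentiable (by simp)
  have e : ∀ i j x, pd i (pd j f) x =
      fderiv ℝ (fderiv ℝ f) x (Pi.single i 1) (Pi.single j 1) := by
    intro i j x
    have := ((hd x).hasFDerivAt.clm_apply (hasFDerivAt_const (Pi.single j (1 : ℝ)) x)).fderiv
    simp only [pd]
    change fderiv ℝ (fun y => fderiv ℝ f y (Pi.single j 1)) x (Pi.single i 1) = _
    rw [this]; simp
  ext x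
  rw [e, e]
  exact (hf.contDiffAt.isSymmSndFDerivAt (by
    rw [minSmoothness_of_isRCLikeNormedField]; exact WithTop.coe_le_coe.2 le_top)).eq _ _

theorem integral_pd_eq_zero {f : (Fin 2 → ℝ) → ℝ} (hf : ContDiff ℝ (⊤ : ℕ∞) f) (hp : Prdc 1 f)
    (i : Fin 2) : ∫ x in box 2 1, pd i f x = 0 := by
  have c := (pd_contDiff hf i).continuous
  have cs : ∀ z : Fin 2 → ℝ, Continuous fun s : ℝ => pd i f (Function.update z i s) :=
    fun z => c.comp (continuous_const.update i continuous_id)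
  have key : ∀ z : Fin 2 → ℝ, ∫ s in (0 : ℝ)..1, pd i f (Function.update z i s) = 0 := by
    intro z
    rw [intervalIntegral.integral_eq_sub_of_hasDerivAt
      (fun s _ => hasDerivAt_update_slice hf i z s) ((cs z).intervalIntegrable _ _), sub_eq_zero,
      ← hp (Function.update z i 0) i]
    congr 1
    ext j
    by_cases h : j = i
    · subst h; simp
    · simp [h]
  fin_cases i
  · simp only [Fin.zero_eta] at c key ⊢
    rw [integral_box_eq_swap c]
    have : ∀ y : ℝ, ∫ s in (0 : ℝ)..1, pd 0 f ![s, y] = 0 := fun y => by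
      simpa only [update_vec_zero] using key ![0, y]
    simp [this]
  · simp only [Fin.mk_one] at c key ⊢
    rw [integral_box_eq c]
    have : ∀ y : ℝ, ∫ s in (0 : ℝ)..1, pd 1 f ![y, s] = 0 := fun y => by
      simpa only [update_vec_one] using key ![y, 0]
    simp [this]

theorem continuous_slice_integral_zero {g : (Fin 2 → ℝ) → ℝ} (hg : Continuous g) :
    Continuous fun y : ℝ => ∫ s in (0 : ℝ)..1, g ![s, y] :=
  intervalIntegral.continuous_parametric_intervalIntegral_of_continuous' (μ := volume)
    (f := fun y s => g ![s, y]) (hg.comp (by fun_prop)) 0 1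

theorem continuous_slice_integral_one {g : (Fin 2 → ℝ) → ℝ} (hg : Continuous g) :
    Continuous fun x : ℝ => ∫ s in (0 : ℝ)..1, g ![x, s] :=
  intervalIntegral.continuous_parametric_intervalIntegral_of_continuous' (μ := volume)
    (f := fun x s => g ![x, s]) (hg.comp (by fun_prop)) 0 1

theorem box_poincare {f : (Fin 2 → ℝ) → ℝ} (hf : ContDiff ℝ (⊤ : ℕ∞) f)
    (h0 : ∫ x in box 2 1, f x = 0) :
    ∫ x in box 2 1, f x ^ 2 ≤
      (∫ x in box 2 1, pd 0 f x ^ 2) + ∫ x in box 2 1, pd 1 f x ^ 2 := by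
  have cf := hf.continuous
  have c0 := (pd_contDiff hf 0).continuous
  have c1 := (pd_contDiff hf 1).continuous
  set P : ℝ → ℝ := fun y => ∫ s in (0 : ℝ)..1, pd 0 f ![s, y] ^ 2 with hP
  set Q : ℝ → ℝ := fun x => ∫ s in (0 : ℝ)..1, pd 1 f ![x, s] ^ 2 with hQ
  have cP : Continuous P := continuous_slice_integral_zero (c0.pow 2)
  have cQ : Continuous Q := continuous_slice_integral_one (c1.pow 2)
  have cP' : Continuous fun z : Fin 2 → ℝ => P (z 1) := cP.comp (continuous_apply 1)
  have cQ' : Continuous fun z : Fin 2 → ℝ => Q (z 0) := cQ.comp (continuous_apply 0)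
  have IP : ∫ z in box 2 1, P (z 1) = ∫ x in box 2 1, pd 0 f x ^ 2 := by
    rw [integral_box_eq_swap cP', integral_box_eq_swap (f := fun x => pd 0 f x ^ 2) (c0.pow 2)]
    simp [hP]
  have IQ : ∫ z in box 2 1, Q (z 0) = ∫ x in box 2 1, pd 1 f x ^ 2 := by
    rw [integral_box_eq cQ', integral_box_eq (f := fun x => pd 1 f x ^ 2) (c1.pow 2)]
    simp [hQ]
  have pt : ∀ x ∈ Icc (0 : ℝ) 1, ∀ y ∈ Icc (0 : ℝ) 1, ∀ x' ∈ Icc (0 : ℝ) 1, ∀ y' ∈ Icc (0 : ℝ) 1,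
      (f ![x, y] - f ![x', y']) ^ 2 ≤ 2 * P y + 2 * Q x' := by
    intro x hx y hy x' hx' y' hy'
    have h1 := sq_sub_le_integral (hasDerivAt_slice_zero hf y) (c0.comp (by fun_prop)) hx hx'
    have h2 := sq_sub_le_integral (hasDerivAt_slice_one hf x') (c1.comp (by fun_prop)) hy hy'
    simp only [hP, hQ]
    nlinarith [sq_nonneg ((f ![x, y] - f ![x', y]) - (f ![x', y] - f ![x', y']))]
  have first : ∀ x' ∈ Icc (0 : ℝ) 1, ∀ y' ∈ Icc (0 : ℝ) 1,
      (∫ x in box 2 1, f x ^ 2) + f ![x', y'] ^ 2 ≤ 2 * (∫ x in box 2 1, pd 0 f x ^ 2) + 2 * Q x' := by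
    intro x' hx' y' hy'
    have h := integral_box_mono (f := fun z => (f z - f ![x', y']) ^ 2)
      (g := fun z => 2 * P (z 1) + 2 * Q x') (by fun_prop) (by fun_prop)
      fun x hx y hy => by simpa using pt x hx y hy x' hx' y' hy'
    have e1 : ∫ z in box 2 1, (f z - f ![x', y']) ^ 2 =
        (∫ x in box 2 1, f x ^ 2) + f ![x', y'] ^ 2 := by
      have : ∀ z, (f z - f ![x', y']) ^ 2 =
          f z ^ 2 - 2 * f ![x', y'] * f z + f ![x', y'] ^ 2 := fun z => by ring
      simp only [this]
      rw [integral_add (integrableOn_box (by fun_prop)) (integrableOn_box (by fun_prop)),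
        integral_sub (integrableOn_box (by fun_prop)) (integrableOn_box (by fun_prop)),
        integral_const_mul, h0, integral_box_const]
      ring
    rw [e1, integral_add (integrableOn_box (by fun_prop)) (integrableOn_box (by fun_prop)),
      integral_box_const, integral_const_mul, IP] at h
    exact h
  have h := integral_box_mono (f := fun z => (∫ x in box 2 1, f x ^ 2) + f z ^ 2)
    (g := fun z => 2 * (∫ x in box 2 1, pd 0 f x ^ 2) + 2 * Q (z 0)) (by fun_prop) (by fun_prop)
    fun x hx y hy => by simpa using first x hx y hy
  rw [integral_add (integrableOn_box (by fun_prop)) (integrableOn_box (by fun_prop)),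
    integral_add (integrableOn_box (by fun_prop)) (integrableOn_box (by fun_prop)),
    integral_box_const, integral_box_const, integral_const_mul, IQ] at h
  linarith

theorem box_agmon {f : (Fin 2 → ℝ) → ℝ} (hf : ContDiff ℝ (⊤ : ℕ∞) f) {s : ℝ} (hs : 0 < s) :
    ∫ x in box 2 1, f x ^ 4 ≤
      ((1 + s) * (∫ x in box 2 1, f x * f x) + s⁻¹ * ∫ x in box 2 1, pd 0 f x * pd 0 f x) *
      ((1 + s) * (∫ x in box 2 1, f x * f x) + s⁻¹ * ∫ x in box 2 1, pd 1 f x * pd 1 f x) := by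
  have cf := hf.continuous
  have c : ∀ i, Continuous (pd i f) := fun i => (pd_contDiff hf i).continuous
  set F : Fin 2 → (Fin 2 → ℝ) → ℝ := fun i z =>
    f z ^ 2 + (s * f z ^ 2 + s⁻¹ * pd i f z ^ 2) with hF
  have cF : ∀ i, Continuous (F i) := fun i => by
    have := c i
    simp only [hF]; fun_prop
  have IF : ∀ i, ∫ z in box 2 1, F i z =
      (1 + s) * (∫ x in box 2 1, f x * f x) + s⁻¹ * ∫ x in box 2 1, pd i f x * pd i f x := by
    intro i
    have := c i
    simp only [hF]
    rw [integral_add (integrableOn_box (by fun_prop)) (integrableOn_box (by fun_prop)),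
      integral_add (integrableOn_box (by fun_prop)) (integrableOn_box (by fun_prop)),
      integral_const_mul, integral_const_mul]
    simp only [← sq]
    ring
  have young : ∀ a b : ℝ, |2 * a * b| ≤ s * a ^ 2 + s⁻¹ * b ^ 2 := by
    intro a b
    have e : s * a ^ 2 + s⁻¹ * b ^ 2 - 2 * |a| * |b| = s⁻¹ * (s * |a| - |b|) ^ 2 := by
      rw [← sq_abs a, ← sq_abs b]
      field_simp
      ring
    rw [abs_mul, abs_mul, abs_two]
    have : 0 ≤ s⁻¹ * (s * |a| - |b|) ^ 2 := by positivity
    linarith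
  rw [← IF 0, ← IF 1, integral_box_eq_swap (cF 0), integral_box_eq (cF 1)]
  set g : ℝ → ℝ := fun y => ∫ x in (0 : ℝ)..1, F 0 ![x, y] with hg
  set k : ℝ → ℝ := fun x => ∫ y in (0 : ℝ)..1, F 1 ![x, y] with hk
  have cg : Continuous g := continuous_slice_integral_zero (cF 0)
  have ck : Continuous k := continuous_slice_integral_one (cF 1)
  have d : ∀ {q q' : ℝ → ℝ}, (∀ s, HasDerivAt q (q' s) s) →
      ∀ s, HasDerivAt (fun s => q s ^ 2) (2 * q s * q' s) s := by
    intro q q' h s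
    simpa using (h s).fun_pow 2
  have hg1 : ∀ x ∈ Icc (0 : ℝ) 1, ∀ y, f ![x, y] ^ 2 ≤ g y := by
    intro x hx y
    have c0 := c 0
    exact le_integral_add (d (hasDerivAt_slice_zero hf y)) (by fun_prop)
      (w := fun t => s * f ![t, y] ^ 2 + s⁻¹ * pd 0 f ![t, y] ^ 2) (by fun_prop)
      (fun t => young _ _) hx
  have hk1 : ∀ x, ∀ y ∈ Icc (0 : ℝ) 1, f ![x, y] ^ 2 ≤ k x := by
    intro x y hy
    have c1 := c 1
    exact le_integral_add (d (hasDerivAt_slice_one hf x)) (by fun_prop)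
      (w := fun t => s * f ![x, t] ^ 2 + s⁻¹ * pd 1 f ![x, t] ^ 2) (by fun_prop)
      (fun t => young _ _) hy
  have h := integral_box_mono (f := fun z => f z ^ 4) (g := fun z => k (z 0) * g (z 1))
    (by fun_prop) (by fun_prop) fun x hx y hy => by
      have a1 := hg1 x hx y
      have a2 := hk1 x y hy
      have := mul_le_mul a2 a1 (sq_nonneg _) ((sq_nonneg _).trans a2)
      simp only [Matrix.cons_val_zero, Matrix.cons_val_one]
      calc f ![x, y] ^ 4 = f ![x, y] ^ 2 * f ![x, y] ^ 2 := by ring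
        _ ≤ _ := this
  refine h.trans_eq ?_
  rw [integral_box_eq (by fun_prop)]
  simp only [Matrix.cons_val_zero, Matrix.cons_val_one, intervalIntegral.integral_const_mul,
    intervalIntegral.integral_mul_const]
  rw [mul_comm]

/-- The algebra of smooth functions on the flat torus `ℝ²/ℤ²`. -/
def smoothPer : Subalgebra ℝ ((Fin 2 → ℝ) → ℝ) where
  carrier := {f | ContDiff ℝ (⊤ : ℕ∞) f ∧ Prdc 1 f}
  mul_mem' := fun {f g} hf hg => ⟨hf.1.mul hg.1, fun x i => by simp [hf.2 x i, hg.2 x i]⟩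
  add_mem' := fun {f g} hf hg => ⟨hf.1.add hg.1, fun x i => by simp [hf.2 x i, hg.2 x i]⟩
  algebraMap_mem' := fun c => ⟨contDiff_const, fun _ _ => rfl⟩

/-- Partial derivatives as derivations of `smoothPer`. -/
def pdDer (i : Fin 2) : Derivation ℝ smoothPer smoothPer :=
  Derivation.mk'
    { toFun := fun f => ⟨pd i f, pd_contDiff f.2.1 i, pd_prdc f.2.2 i⟩
      map_add' := fun f g => by
        ext x
        have hf := (f.2.1.differentiable (by simp)) x
        have hg := (g.2.1.differentiable (by simp)) x
        change fderiv ℝ (f.1 + g.1) x _ = _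
        rw [fderiv_add hf hg]; rfl
      map_smul' := fun c f => by
        ext x
        have hf := (f.2.1.differentiable (by simp)) x
        change fderiv ℝ (c • f.1) x _ = _
        rw [fderiv_const_smul hf]; rfl }
    fun f g => by
      ext x
      have hf := (f.2.1.differentiable (by simp)) x
      have hg := (g.2.1.differentiable (by simp)) x
      change fderiv ℝ (f.1 * g.1) x _ = _
      rw [fderiv_mul hf hg]; rfl

theorem smoothPer_continuous (f : smoothPer) : Continuous (f : (Fin 2 → ℝ) → ℝ) :=
  f.2.1.continuous

/-- Integration over the torus. -/
def torusInt : smoothPer →ₗ[ℝ] ℝ where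
  toFun f := ∫ x in box 2 1, (f : (Fin 2 → ℝ) → ℝ) x
  map_add' f g := integral_add (integrableOn_box (smoothPer_continuous f))
    (integrableOn_box (smoothPer_continuous g))
  map_smul' c _ := integral_const_mul c _

/-- The calculus of smooth functions on the flat torus. -/
def torusCalculus : TorusCalculus smoothPer where
  D := pdDer
  I := torusInt
  comm i j f := Subtype.ext (pd_comm f.2.1 i j)
  I_D i f := integral_pd_eq_zero f.2.1 f.2.2 i
  I_nonneg f := integral_nonneg fun x => mul_self_nonneg ((f : (Fin 2 → ℝ) → ℝ) x)
  poincare f hf := by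
    have h := box_poincare f.2.1 hf
    simp only [sq] at h
    rw [Fin.sum_univ_two]
    exact h
  agmon f s hs := box_agmon f.2.1 hs

/-- Joint smoothness of a time-dependent function on `J × ℝ²`. -/
def SmoothTime (J : Set ℝ) (F : ℝ → (Fin 2 → ℝ) → ℝ) : Prop :=
  ContDiffOn ℝ (⊤ : ℕ∞) (fun p : ℝ × (Fin 2 → ℝ) => F p.1 p.2) (J ×ˢ univ)

/-- Time derivative of a time-dependent function. -/
def dtime (F : ℝ → (Fin 2 → ℝ) → ℝ) (t : ℝ) (x : Fin 2 → ℝ) : ℝ := deriv (fun s => F s x) t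

namespace SmoothTime

variable {J : Set ℝ} {F G : ℝ → (Fin 2 → ℝ) → ℝ} {t : ℝ}

theorem mono {J' : Set ℝ} (h : SmoothTime J F) (hJ : J' ⊆ J) : SmoothTime J' F :=
  ContDiffOn.mono h (prod_mono hJ Subset.rfl)

theorem mul (hF : SmoothTime J F) (hG : SmoothTime J G) :
    SmoothTime J fun t x => F t x * G t x :=
  ContDiffOn.mul hF hG

theorem slice (h : SmoothTime J F) (ht : t ∈ J) : ContDiff ℝ (⊤ : ℕ∞) (F t) := by
  rw [← contDiffOn_univ]
  exact ContDiffOn.comp (g := fun p : ℝ × (Fin 2 → ℝ) => F p.1 p.2) (f := fun x => (t, x)) h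
    (contDiff_prodMk_right t).contDiffOn fun x _ => ⟨ht, mem_univ _⟩

theorem pd_eq_fderivWithin (h : SmoothTime J F) (ht : t ∈ J) (i : Fin 2) (x : Fin 2 → ℝ) :
    pd i (F t) x = fderivWithin ℝ (fun p : ℝ × (Fin 2 → ℝ) => F p.1 p.2) (J ×ˢ univ) (t, x)
      (0, Pi.single i 1) := by
  have h1 := (ContDiffOn.differentiableOn h (by simp) (t, x) ⟨ht, mem_univ _⟩).hasFDerivWithinAt
  have h2 := h1.comp x (hasFDerivAt_prodMk_right t x).hasFDerivWithinAt
    (s := univ) (fun y _ => ⟨ht, mem_univ _⟩)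
  have h3 := (hasFDerivWithinAt_univ.1 h2).fderiv
  change fderiv ℝ (F t) x = _ at h3
  rw [pd, h3]
  simp

theorem pd (h : SmoothTime J F) (hJ : UniqueDiffOn ℝ J) (i : Fin 2) :
    SmoothTime J fun t => pd i (F t) := by
  refine ContDiffOn.congr ((ContDiffOn.fderivWithin h (hJ.prod uniqueDiffOn_univ)
    (m := (⊤ : ℕ∞)) (by simp)).clm_apply
    (contDiffOn_const (c := ((0 : ℝ), Pi.single i (1 : ℝ))))) fun p hp => ?_
  exact h.pd_eq_fderivWithin hp.1 i p.2

theorem pdList (h : SmoothTime J F) (hJ : UniqueDiffOn ℝ J) (l : List (Fin 2)) :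
    SmoothTime J fun t => pdList l (F t) := by
  induction l with
  | nil => exact h
  | cons i l ih => exact ih.pd hJ i

section Open

variable (h : SmoothTime (Ioi 0) F) (ht : 0 < t)
include h ht

theorem contDiffAt (x : Fin 2 → ℝ) :
    ContDiffAt ℝ (⊤ : ℕ∞) (fun p : ℝ × (Fin 2 → ℝ) => F p.1 p.2) (t, x) :=
  ContDiffOn.contDiffAt h ((isOpen_Ioi.prod isOpen_univ).mem_nhds ⟨ht, mem_univ _⟩)

theorem hasDerivAt_fderiv (x : Fin 2 → ℝ) :
    HasDerivAt (fun s => F s x)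
      (fderiv ℝ (fun p : ℝ × (Fin 2 → ℝ) => F p.1 p.2) (t, x) (1, 0)) t := by
  have h1 := ((h.contDiffAt ht x).differentiableAt (by simp)).hasFDerivAt
  have h2 := HasFDerivAt.comp_hasDerivAt (f := fun s : ℝ => (s, x)) t h1
    ((hasDerivAt_id t).prodMk (hasDerivAt_const t x))
  exact h2

theorem dtime_eq (x : Fin 2 → ℝ) :
    dtime F t x = fderiv ℝ (fun p : ℝ × (Fin 2 → ℝ) => F p.1 p.2) (t, x) (1, 0) :=
  (h.hasDerivAt_fderiv ht x).deriv

theorem hasDerivAt (x : Fin 2 → ℝ) : HasDerivAt (fun s => F s x) (dtime F t x) t := by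
  rw [h.dtime_eq ht]
  exact h.hasDerivAt_fderiv ht x

omit ht in
theorem dtime : SmoothTime (Ioi 0) (dtime F) := by
  refine ContDiffOn.congr ((ContDiffOn.fderiv_of_isOpen h (isOpen_Ioi.prod isOpen_univ)
    (m := (⊤ : ℕ∞)) (by simp)).clm_apply
    (contDiffOn_const (c := ((1 : ℝ), (0 : Fin 2 → ℝ))))) fun p hp => ?_
  exact h.dtime_eq hp.1 p.2

theorem pd_eq_fderiv (i : Fin 2) (x : Fin 2 → ℝ) :
    _root_.pd i (F t) x =
      fderiv ℝ (fun p : ℝ × (Fin 2 → ℝ) => F p.1 p.2) (t, x) (0, Pi.single i 1) := by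
  rw [h.pd_eq_fderivWithin ht, fderivWithin_of_isOpen (isOpen_Ioi.prod isOpen_univ) (mk_mem_prod (mem_Ioi.2 ht) (mem_univ _))]

theorem pd_dtime (i : Fin 2) :
    _root_.pd i (_root_.dtime F t) = _root_.dtime (fun s => _root_.pd i (F s)) t := by
  ext x
  set Φ := fun p : ℝ × (Fin 2 → ℝ) => F p.1 p.2 with hΦ
  have hd : DifferentiableAt ℝ (fderiv ℝ Φ) (t, x) :=
    ((h.contDiffAt ht x).fderiv_right (m := (⊤ : ℕ∞)) (by simp)).differentiableAt (by simp)
  have e : ∀ v w : ℝ × (Fin 2 → ℝ), fderiv ℝ (fun p => fderiv ℝ Φ p w) (t, x) v =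
      fderiv ℝ (fderiv ℝ Φ) (t, x) v w := by
    intro v w
    rw [(hd.hasFDerivAt.clm_apply (hasFDerivAt_const w _)).fderiv]
    simp
  have sy := (h.contDiffAt ht x).isSymmSndFDerivAt (by
    rw [minSmoothness_of_isRCLikeNormedField]; exact WithTop.coe_le_coe.2 le_top)
  have u0 : UniqueDiffOn ℝ (Ioi (0 : ℝ)) := isOpen_Ioi.uniqueDiffOn
  have hO : (Ioi (0 : ℝ) ×ˢ (univ : Set (Fin 2 → ℝ))) ∈ nhds (t, x) :=
    (isOpen_Ioi.prod isOpen_univ).mem_nhds ⟨ht, mem_univ _⟩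
  rw [h.dtime.pd_eq_fderiv ht, (h.pd u0 i).dtime_eq ht]
  have e1 : (fun p : ℝ × (Fin 2 → ℝ) => _root_.dtime F p.1 p.2) =ᶠ[nhds (t, x)]
      fun p => fderiv ℝ Φ p (1, 0) := by
    filter_upwards [hO] with p hp using h.dtime_eq hp.1 p.2
  have e2 : (fun p : ℝ × (Fin 2 → ℝ) => _root_.pd i (F p.1) p.2) =ᶠ[nhds (t, x)]
      fun p => fderiv ℝ Φ p (0, Pi.single i 1) := by
    filter_upwards [hO] with p hp using h.pd_eq_fderiv hp.1 i p.2
  rw [e1.fderiv_eq, e2.fderiv_eq, e, e, sy.eq]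

theorem pdList_dtime (l : List (Fin 2)) :
    _root_.pdList l (_root_.dtime F t) = _root_.dtime (fun s => _root_.pdList l (F s)) t := by
  induction l with
  | nil => rfl
  | cons i l ih =>
    change _root_.pd i (_root_.pdList l _) = _
    rw [ih, (h.pdList isOpen_Ioi.uniqueDiffOn l).pd_dtime ht]
    rfl

theorem hasDerivAt_integral :
    HasDerivAt (fun s => ∫ x in box 2 1, F s x) (∫ x in box 2 1, _root_.dtime F t x) t := by
  have hs : Icc (t / 2) (2 * t) ⊆ Ioi (0 : ℝ) := fun s hs => lt_of_lt_of_le (by linarith) hs.1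
  obtain ⟨M, hM⟩ := ((isCompact_Icc (a := t / 2) (b := 2 * t)).prod
    (isCompact_box 2 1)).exists_bound_of_continuousOn
    ((ContDiffOn.continuousOn h.dtime).mono (prod_mono hs (subset_univ _)))
  have ae : ∀ᵐ x ∂(volume.restrict (box 2 1)), x ∈ box 2 1 :=
    ae_restrict_mem (isCompact_box 2 1).measurableSet
  refine (hasDerivAt_integral_of_dominated_loc_of_deriv_le (bound := fun _ => M)
    (F' := _root_.dtime F)
    (Icc_mem_nhds (by linarith : t / 2 < t) (by linarith : t < 2 * t)) ?_
    (integrableOn_box (h.slice ht).continuous) ?_ ?_ ?_ ?_).2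
  · filter_upwards [Ioi_mem_nhds ht] with s hs
    exact (h.slice hs).continuous.aestronglyMeasurable
  · exact (h.dtime.slice ht).continuous.aestronglyMeasurable
  · filter_upwards [ae] with x hx s hs' using hM (s, x) ⟨hs', hx⟩
  · exact integrableOn_box continuous_const
  · exact Filter.Eventually.of_forall fun x s hs' => h.hasDerivAt (hs hs') x

omit h in
theorem dtime_prdc (hp : ∀ s, 0 ≤ s → Prdc 1 (F s)) : Prdc 1 (_root_.dtime F t) := by
  intro x i
  refine Filter.EventuallyEq.deriv_eq ?_
  filter_upwards [Ioi_mem_nhds ht] with s hs using hp s (le_of_lt hs) x i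

theorem hasDerivAt_integral_mul_self :
    HasDerivAt (fun s => ∫ x in box 2 1, F s x * F s x)
      (2 * ∫ x in box 2 1, F t x * _root_.dtime F t x) t := by
  have h1 := (h.mul h).hasDerivAt_integral ht
  have e : ∀ x, _root_.dtime (fun s x => F s x * F s x) t x = 2 * (F t x * _root_.dtime F t x) := by
    intro x
    refine ((h.hasDerivAt ht x).mul (h.hasDerivAt ht x)).deriv.trans ?_
    ring
  simp only [e] at h1
  rwa [integral_const_mul] at h1

end Open

theorem continuousOn_integral (h : SmoothTime (Ici 0) F) :
    ContinuousOn (fun t => ∫ x in box 2 1, F t x) (Ici 0) := by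
  have hc : Continuous (fun p : ℝ × (Fin 2 → ℝ) => F (max p.1 0) p.2) :=
    (ContDiffOn.continuousOn h).comp_continuous
      (f := fun p : ℝ × (Fin 2 → ℝ) => (max p.1 0, p.2)) (by fun_prop)
      fun p => ⟨mem_Ici.2 (le_max_right _ _), mem_univ _⟩
  have := continuous_parametric_integral_of_continuous (μ := volume)
    (f := fun t x => F (max t 0) x) hc (isCompact_box 2 1)
  refine this.continuousOn.congr fun t ht => ?_
  simp only [max_eq_left (mem_Ici.1 ht)]

end SmoothTime

theorem torusCalculus_dl_coe (l : List (Fin 2)) (f : smoothPer) :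
    (torusCalculus.dl l f : (Fin 2 → ℝ) → ℝ) = pdList l f := by
  induction l with
  | nil => rfl
  | cons i l ih =>
    change pd i _ = pd i _
    rw [ih]

open Classical in
/-- The element of `smoothPer` given by a smooth periodic function (and `0` otherwise). -/
def toPer (f : (Fin 2 → ℝ) → ℝ) : smoothPer := if h : f ∈ smoothPer then ⟨f, h⟩ else 0

theorem toPer_coe {f : (Fin 2 → ℝ) → ℝ} (h : f ∈ smoothPer) :
    (toPer f : (Fin 2 → ℝ) → ℝ) = f := by
  simp [toPer, h]

/-- The components of a vector field, as elements of `smoothPer`. -/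
def perField (w : (Fin 2 → ℝ) → Fin 2 → ℝ) (i : Fin 2) : smoothPer := toPer fun x => w x i

/-- The components of the time derivative of a vector field, as elements of `smoothPer`. -/
def perDtime (w : ℝ → (Fin 2 → ℝ) → Fin 2 → ℝ) (t : ℝ) (i : Fin 2) : smoothPer :=
  toPer (dtime (fun s x => w s x i) t)

/-- Vector fields that are periodic in space and smooth in `(t, x)` for `t ≥ 0`. -/
structure SmoothField (w : ℝ → (Fin 2 → ℝ) → Fin 2 → ℝ) : Prop where
  smooth : ∀ i, SmoothTime (Ici 0) fun t x => w t x i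
  prdc : ∀ t, 0 ≤ t → ∀ i, Prdc 1 fun x => w t x i

namespace SmoothField

variable {w : ℝ → (Fin 2 → ℝ) → Fin 2 → ℝ} {t : ℝ} (h : SmoothField w)
include h

theorem smooth_pos (i : Fin 2) : SmoothTime (Ioi 0) fun t x => w t x i :=
  (h.smooth i).mono Ioi_subset_Ici_self

theorem mem_smoothPer (ht : 0 ≤ t) (i : Fin 2) : (fun x => w t x i) ∈ smoothPer :=
  ⟨(h.smooth i).slice (mem_Ici.2 ht), h.prdc t ht i⟩

theorem perField_coe (ht : 0 ≤ t) (i : Fin 2) :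
    (perField (w t) i : (Fin 2 → ℝ) → ℝ) = fun x => w t x i :=
  toPer_coe (h.mem_smoothPer ht i)

theorem perDtime_coe (ht : 0 < t) (i : Fin 2) :
    (perDtime w t i : (Fin 2 → ℝ) → ℝ) = dtime (fun s x => w s x i) t :=
  toPer_coe ⟨(h.smooth_pos i).dtime.slice ht,
    SmoothTime.dtime_prdc ht fun s hs => h.prdc s hs i⟩

theorem en_eq (ht : 0 ≤ t) (l : List (Fin 2)) :
    torusCalculus.en l (perField (w t)) =
      ∑ i, ∫ x in box 2 1, pdList l (fun y => w t y i) x * pdList l (fun y => w t y i) x := by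
  refine Finset.sum_congr rfl fun i _ => ?_
  change ∫ x in box 2 1, (torusCalculus.dl l (perField (w t) i) : (Fin 2 → ℝ) → ℝ) x *
    (torusCalculus.dl l (perField (w t) i) : (Fin 2 → ℝ) → ℝ) x = _
  rw [torusCalculus_dl_coe, h.perField_coe ht]

theorem continuousOn_en (l : List (Fin 2)) :
    ContinuousOn (fun t => torusCalculus.en l (perField (w t))) (Ici 0) := by
  refine ContinuousOn.congr (continuousOn_finsetSum _ fun i _ => ?_) fun t ht => h.en_eq ht l
  have := (h.smooth i).pdList (uniqueDiffOn_Ici 0) l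
  exact (this.mul this).continuousOn_integral

theorem hasDerivAt_en (ht : 0 < t) (l : List (Fin 2)) :
    HasDerivAt (fun t => torusCalculus.en l (perField (w t)))
      (2 * ∑ i, torusCalculus.I (torusCalculus.dl l (perField (w t) i) *
        torusCalculus.dl l (perDtime w t i))) t := by
  have e : (fun t => torusCalculus.en l (perField (w t))) =ᶠ[nhds t] fun t =>
      ∑ i, ∫ x in box 2 1, pdList l (fun y => w t y i) x * pdList l (fun y => w t y i) x := by
    filter_upwards [Ioi_mem_nhds ht] with s hs using h.en_eq (le_of_lt hs) l
  refine HasDerivAt.congr_of_eventuallyEq ?_ e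
  rw [Finset.mul_sum]
  refine HasDerivAt.fun_sum fun i _ => ?_
  have h1 := ((h.smooth_pos i).pdList isOpen_Ioi.uniqueDiffOn l).hasDerivAt_integral_mul_self ht
  rw [← (h.smooth_pos i).pdList_dtime ht] at h1
  refine h1.congr_deriv ?_
  change _ = 2 * ∫ x in box 2 1, (torusCalculus.dl l (perField (w t) i) : (Fin 2 → ℝ) → ℝ) x *
    (torusCalculus.dl l (perDtime w t i) : (Fin 2 → ℝ) → ℝ) x
  rw [torusCalculus_dl_coe, torusCalculus_dl_coe, h.perField_coe ht.le, h.perDtime_coe ht]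

theorem mean_eq (ht : 0 ≤ t) (i : Fin 2) :
    torusCalculus.I (perField (w t) i) = ∫ x in box 2 1, w t x i := by
  change ∫ x in box 2 1, (perField (w t) i : (Fin 2 → ℝ) → ℝ) x = _
  rw [h.perField_coe ht]

theorem mean_eq_zero (h0 : ZeroAvg 1 (w 0))
    (hd : ∀ t, 0 < t → ∀ i, torusCalculus.I (perDtime w t i) = 0) (ht : 0 ≤ t) (i : Fin 2) :
    torusCalculus.I (perField (w t) i) = 0 := by
  have hc := (h.smooth i).continuousOn_integral
  have hD : ∀ t, 0 < t → HasDerivAt (fun s => ∫ x in box 2 1, w s x i) 0 t := fun t ht => by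
    refine ((h.smooth_pos i).hasDerivAt_integral ht).congr_deriv ?_
    rw [← h.perDtime_coe ht]
    exact hd t ht i
  have h1 := antitoneOn_Ici_of_hasDerivAt hc hD (fun _ _ => le_rfl) self_mem_Ici ht ht
  have h2 := antitoneOn_Ici_of_hasDerivAt hc.neg (fun t ht => (hD t ht).neg)
    (fun _ _ => neg_zero.le) self_mem_Ici ht ht
  have h3 := h0 i
  rw [h.mean_eq ht]
  simp only [Pi.neg_apply] at h2
  linarith

theorem enS_eq_integral_gradSq (ht : 0 ≤ t) (r : ℕ) :
    torusCalculus.enS (Finset.Nat.antidiagonalTuple 2 r) mIdxList (perField (w t)) =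
      ∫ x in box 2 1, gradSq r (w t) x := by
  have c : ∀ (α : Fin 2 → ℕ) i, IntegrableOn (fun x => pdM α (fun y => w t y i) x ^ 2) (box 2 1) :=
    fun α i => integrableOn_box
      ((((h.smooth i).pdList (uniqueDiffOn_Ici 0) _).slice (mem_Ici.2 ht)).continuous.pow 2)
  simp only [gradSq]
  rw [integral_finsetSum _ fun α _ => integrable_finsetSum _ fun i _ => c α i]
  refine Finset.sum_congr rfl fun α _ => ?_
  rw [integral_finsetSum _ fun i _ => c α i, h.en_eq ht]
  simp only [pdM, sq]

theorem en_nil_eq_HnormSq (ht : 0 ≤ t) :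
    torusCalculus.en [] (perField (w t)) = HnormSq 1 0 (w t) := by
  have h1 := h.enS_eq_integral_gradSq ht 0
  simp only [HnormSq, zero_add, Finset.sum_range_one, ← h1]
  simp [TorusCalculus.enS, mIdxList, Finset.Nat.antidiagonalTuple_zero_right]

end SmoothField

theorem exists_perm_mIdxList (r : ℕ) (l : List (Fin 2)) (hl : l.length = r) :
    ∃ α ∈ Finset.Nat.antidiagonalTuple 2 r, (mIdxList α).Perm l := by
  refine ⟨fun i => l.count i, ?_, ?_⟩
  · rw [Finset.Nat.mem_antidiagonalTuple, ← hl, ← Multiset.coe_card,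
      ← Multiset.sum_count_eq_card (s := Finset.univ) (m := (l : Multiset (Fin 2))) (by simp)]
    simp
  · rw [List.perm_iff_count]
    intro a
    fin_cases a <;> simp [mIdxList, List.finRange_succ, List.count_replicate]

theorem length_mIdxList {r : ℕ} {α : Fin 2 → ℕ} (h : α ∈ Finset.Nat.antidiagonalTuple 2 r) :
    (mIdxList α).length = r := by
  rw [Finset.Nat.mem_antidiagonalTuple, Fin.sum_univ_two] at h
  simpa [mIdxList, List.finRange_succ] using h

theorem card_antidiagonalTuple_two (r : ℕ) :
    (Finset.Nat.antidiagonalTuple 2 r).card = r + 1 := by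
  rw [Finset.Nat.antidiagonalTuple_two]
  simp

theorem TorusCalculus.I_sum_mul_D {A : Type*} [CommRing A] [Algebra ℝ A] (T : TorusCalculus A)
    (v : Fin 2 → A) (hv : ∑ j, T.D j (v j) = 0) (f : A) : T.I (∑ j, v j * T.D j f) = 0 := by
  rw [T.sum_mul_D_eq v hv, map_sum]
  exact Finset.sum_eq_zero fun j _ => T.I_D j _

namespace IsMHD

variable {ν η : ℝ} {u b : ℝ → (Fin 2 → ℝ) → Fin 2 → ℝ} {P : ℝ → (Fin 2 → ℝ) → ℝ}
  (h : IsMHD 2 1 ν η (Ici 0) u b P)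
include h

theorem smoothField_u : SmoothField u where
  smooth i := contDiffOn_pi.1 h.smooth_u i
  prdc t ht i x j := congrFun (h.periodic_u t ht x j) i

theorem smoothField_b : SmoothField b where
  smooth i := contDiffOn_pi.1 h.smooth_b i
  prdc t ht i x j := congrFun (h.periodic_b t ht x j) i

theorem toPer_pressure_coe {t : ℝ} (ht : 0 ≤ t) : (toPer (P t) : (Fin 2 → ℝ) → ℝ) = P t :=
  toPer_coe ⟨SmoothTime.slice (F := P) h.smooth_P (mem_Ici.2 ht), h.periodic_P t ht⟩

theorem perField_div_u {t : ℝ} (ht : 0 ≤ t) :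
    ∑ j, torusCalculus.D j (perField (u t) j) = 0 := by
  refine Subtype.ext (funext fun x => ?_)
  have := h.div_u t ht x
  simp only [divg, Fin.sum_univ_two] at this ⊢
  change pd 0 (perField (u t) 0 : (Fin 2 → ℝ) → ℝ) x +
    pd 1 (perField (u t) 1 : (Fin 2 → ℝ) → ℝ) x = 0
  rwa [h.smoothField_u.perField_coe ht, h.smoothField_u.perField_coe ht]

theorem perField_div_b {t : ℝ} (ht : 0 ≤ t) :
    ∑ j, torusCalculus.D j (perField (b t) j) = 0 := by
  refine Subtype.ext (funext fun x => ?_)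
  have := h.div_b t ht x
  simp only [divg, Fin.sum_univ_two] at this ⊢
  change pd 0 (perField (b t) 0 : (Fin 2 → ℝ) → ℝ) x +
    pd 1 (perField (b t) 1 : (Fin 2 → ℝ) → ℝ) x = 0
  rwa [h.smoothField_b.perField_coe ht, h.smoothField_b.perField_coe ht]

theorem perField_momentum {t : ℝ} (ht : 0 < t) (i : Fin 2) :
    perDtime u t i + (∑ j, perField (u t) j * torusCalculus.D j (perField (u t) i)) +
        torusCalculus.D i (toPer (P t)) =
      ν • (∑ j, torusCalculus.D j (torusCalculus.D j (perField (u t) i))) +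
        ∑ j, perField (b t) j * torusCalculus.D j (perField (b t) i) := by
  refine Subtype.ext (funext fun x => ?_)
  have := h.momentum t ht.le ht x i
  simp only [Fin.sum_univ_two] at this ⊢
  have eu := h.smoothField_u.perField_coe ht.le
  have eb := h.smoothField_b.perField_coe ht.le
  have ed := h.smoothField_u.perDtime_coe ht
  have ep := h.toPer_pressure_coe ht.le
  generalize perField (u t) = U at *
  generalize perField (b t) = B at *
  generalize perDtime u t = V at *
  generalize toPer (P t) = p at *
  change (V i).1 x + ((U 0).1 x * pd 0 (U i).1 x + (U 1).1 x * pd 1 (U i).1 x) + pd i p.1 x =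
    ν * (pd 0 (pd 0 (U i).1) x + pd 1 (pd 1 (U i).1) x) +
    ((B 0).1 x * pd 0 (B i).1 x + (B 1).1 x * pd 1 (B i).1 x)
  rw [eu, eu, eu, eb, eb, eb, ed, ep]
  exact this

theorem perField_induction {t : ℝ} (ht : 0 < t) (i : Fin 2) :
    perDtime b t i + (∑ j, perField (u t) j * torusCalculus.D j (perField (b t) i)) =
      (∑ j, perField (b t) j * torusCalculus.D j (perField (u t) i)) +
        η • ∑ j, torusCalculus.D j (torusCalculus.D j (perField (b t) i)) := by
  refine Subtype.ext (funext fun x => ?_)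
  have := h.induction_eq t ht.le ht x i
  simp only [Fin.sum_univ_two] at this ⊢
  have eu := h.smoothField_u.perField_coe ht.le
  have eb := h.smoothField_b.perField_coe ht.le
  have ed := h.smoothField_b.perDtime_coe ht
  generalize perField (u t) = U at *
  generalize perField (b t) = B at *
  generalize perDtime b t = V at *
  change (V i).1 x + ((U 0).1 x * pd 0 (B i).1 x + (U 1).1 x * pd 1 (B i).1 x) =
    ((B 0).1 x * pd 0 (U i).1 x + (B 1).1 x * pd 1 (U i).1 x) +
    η * (pd 0 (pd 0 (B i).1) x + pd 1 (pd 1 (B i).1) x)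
  rw [eu, eu, eu, eb, eb, eb, ed]
  exact this

theorem I_perDtime_u {t : ℝ} (ht : 0 < t) (i : Fin 2) :
    torusCalculus.I (perDtime u t i) = 0 := by
  have := congrArg torusCalculus.I (h.perField_momentum ht i)
  rw [map_add, map_add, map_add, torusCalculus.I_sum_mul_D _ (h.perField_div_u ht.le),
    torusCalculus.I_sum_mul_D _ (h.perField_div_b ht.le), map_smul, map_sum] at this
  simpa only [torusCalculus.I_D, Finset.sum_const_zero, smul_zero, add_zero] using this

theorem I_perDtime_b {t : ℝ} (ht : 0 < t) (i : Fin 2) :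
    torusCalculus.I (perDtime b t i) = 0 := by
  have := congrArg torusCalculus.I (h.perField_induction ht i)
  rw [map_add, map_add, torusCalculus.I_sum_mul_D _ (h.perField_div_u ht.le),
    torusCalculus.I_sum_mul_D _ (h.perField_div_b ht.le), map_smul, map_sum] at this
  simpa only [torusCalculus.I_D, Finset.sum_const_zero, smul_zero, add_zero] using this

theorem state (hu : ZeroAvg 1 (u 0)) (hb : ZeroAvg 1 (b 0)) {t : ℝ} (ht : 0 < t) :
    torusCalculus.MHDState ν η (perField (u t)) (perField (b t)) (perDtime u t) (perDtime b t)
      (toPer (P t)) where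
  div_u := h.perField_div_u ht.le
  div_b := h.perField_div_b ht.le
  mean_u := h.smoothField_u.mean_eq_zero hu (fun _ hs => h.I_perDtime_u hs) ht.le
  mean_b := h.smoothField_b.mean_eq_zero hb (fun _ hs => h.I_perDtime_b hs) ht.le
  eq_u := h.perField_momentum ht
  eq_b := h.perField_induction ht

theorem velocity_decay (hη : 0 < η) (hν : η ≤ ν) (hu : ZeroAvg 1 (u 0)) (hb : ZeroAvg 1 (b 0))
    (r : ℕ) {t : ℝ} (ht : 0 ≤ t) {K G₀ E₀ : ℝ} (hK : K = TorusCalculus.energyConst r)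
    (hG₀ : G₀ = HnormSq 1 0 (u 0) + HnormSq 1 0 (b 0))
    (hE₀ : E₀ = (∫ x in box 2 1, gradSq r (u 0) x) + ∫ x in box 2 1, gradSq r (b 0) x) :
    ∫ x in box 2 1, gradSq r (u t) x ≤
      ((∫ x in box 2 1, gradSq r (u 0) x) +
        K ^ 2 * G₀ * exp (K ^ 2 / (4 * η ^ 2) * G₀) / (ν * η) * exp ((ν - η) * t) * E₀) *
      exp (K ^ 2 / (4 * η ^ 2) * G₀) * exp (-ν * t) := by
  subst hK hG₀ hE₀
  have su := h.smoothField_u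
  have sb := h.smoothField_b
  have hc := exists_perm_mIdxList r
  have hlen : ∀ α ∈ Finset.Nat.antidiagonalTuple 2 r, (mIdxList α).length = r :=
    fun _ => length_mIdxList
  have hcard := (card_antidiagonalTuple_two r).le
  rw [← su.en_nil_eq_HnormSq le_rfl, ← sb.en_nil_eq_HnormSq le_rfl,
    ← su.enS_eq_integral_gradSq le_rfl, ← sb.enS_eq_integral_gradSq le_rfl,
    ← su.enS_eq_integral_gradSq ht]
  set T := torusCalculus
  set Φ := Finset.Nat.antidiagonalTuple 2 r
  have cS : ∀ {w : ℝ → (Fin 2 → ℝ) → Fin 2 → ℝ}, SmoothField w →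
      ContinuousOn (fun t => T.enS Φ mIdxList (perField (w t))) (Ici 0) := fun hw =>
    continuousOn_finsetSum _ fun α _ => hw.continuousOn_en _
  have dS : ∀ {w : ℝ → (Fin 2 → ℝ) → Fin 2 → ℝ}, SmoothField w → ∀ t, 0 < t →
      HasDerivAt (fun t => T.enS Φ mIdxList (perField (w t))) (∑ α ∈ Φ,
        2 * ∑ i, T.I (T.dl (mIdxList α) (perField (w t) i) *
          T.dl (mIdxList α) (perDtime w t i))) t := fun hw t ht =>
    HasDerivAt.fun_sum fun α _ => hw.hasDerivAt_en ht _
  refine decay_of_differential_inequalities hη hν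
    (G := fun t => T.en [] (perField (u t)) + T.en [] (perField (b t)))
    (E := fun t => T.enS Φ mIdxList (perField (u t)) + T.enS Φ mIdxList (perField (b t)))
    (U := fun t => T.enS Φ mIdxList (perField (u t)))
    (D := fun t => T.dissS Φ mIdxList (perField (u t)) + T.dissS Φ mIdxList (perField (b t)))
    (V := fun t => T.dissS Φ mIdxList (perField (u t)))
    (s := fun t => T.fs (Sum.elim (perField (u t)) (perField (b t))) 1)
    ((su.continuousOn_en _).add (sb.continuousOn_en _)) ((cS su).add (cS sb)) (cS su)
    (fun t ht => (su.hasDerivAt_en ht _).add (sb.hasDerivAt_en ht _))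
    (fun t ht => (dS su t ht).add (dS sb t ht)) (dS su)
    (fun t _ => add_nonneg (T.en_nonneg _ _) (T.en_nonneg _ _))
    (fun t _ => T.enS_nonneg _)
    (fun t _ => add_nonneg (T.enS_nonneg _) (T.enS_nonneg _)) ?_ ?_
    (fun t _ => T.fs_nonneg _ _) ?_ ?_ ?_ ht
  · intro t ht
    have hs := h.state hu hb ht
    exact add_le_add (T.enS_le_dissS _ hs.mean_u) (T.enS_le_dissS _ hs.mean_b)
  · intro t ht
    exact T.enS_le_dissS _ (h.state hu hb ht).mean_u
  · intro t ht
    rw [← mul_add]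
    exact (h.state hu hb ht).basic_energy_le hν
  · intro t ht
    rw [← Finset.sum_add_distrib]
    simp only [← mul_add]
    exact (h.state hu hb ht).total_energy_le hη hν hc hlen hcard
  · intro t ht
    exact (h.state hu hb ht).total_energy_u_le hη hν hc hlen hcard

end IsMHD

theorem gradSq_nonneg {d k : ℕ} (m : ℕ) (w : (Fin d → ℝ) → Fin k → ℝ) (x : Fin d → ℝ) :
    0 ≤ gradSq m w x :=
  Finset.sum_nonneg fun _ _ => Finset.sum_nonneg fun _ _ => sq_nonneg _

theorem HnormSq_eq_sq {d k : ℕ} (L : ℝ) (r : ℕ) (w : (Fin d → ℝ) → Fin k → ℝ) :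
    HnormSq L r w = Hnorm L r w ^ 2 :=
  (Real.sq_sqrt (Finset.sum_nonneg fun m _ => integral_nonneg fun x => gradSq_nonneg m w x)).symm

theorem integral_gradSq_le_Hnorm_sq {d k : ℕ} (L : ℝ) (r : ℕ) (w : (Fin d → ℝ) → Fin k → ℝ) :
    ∫ x in box d L, gradSq r w x ≤ Hnorm L r w ^ 2 := by
  have h0 : ∀ m, 0 ≤ ∫ x in box d L, gradSq m w x :=
    fun m => integral_nonneg fun x => gradSq_nonneg m w x
  rw [← HnormSq_eq_sq]
  exact Finset.single_le_sum (f := fun m => ∫ x in box d L, gradSq m w x) (fun m _ => h0 m)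
    (Finset.self_mem_range_succ r)

theorem sq_add_sq_le_of_add_le {x y c : ℝ} (hx : 0 ≤ x) (hy : 0 ≤ y) (h : x + y ≤ c) :
    x ^ 2 + y ^ 2 ≤ c ^ 2 := by nlinarith [mul_nonneg hx hy]

/-- decay of the velocity for large viscosity in 2D, Theorem 6.6 of the
paper. The constant `C` depends only on `r` and `C₁`. -/
theorem velocity_decay_2d (C₁ : ℝ) (r : ℕ) :
    ∃ C : ℝ, 0 < C ∧
    ∀ ν η N : ℝ, 0 < η → 3 * η < ν → 1 < N →
    ∀ (u b : ℝ → (Fin 2 → ℝ) → Fin 2 → ℝ) (P : ℝ → (Fin 2 → ℝ) → ℝ),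
      IsMHD 2 1 ν η (Set.Ici 0) u b P →
      ZeroAvg 1 (u 0) → ZeroAvg 1 (b 0) →
      (∀ j : ℕ, j ≤ r → Hnorm 1 j (u 0) + Hnorm 1 j (b 0) ≤ C₁ * N ^ j) →
      ∀ t : ℝ, 0 ≤ t →
        (∫ x in box 2 1, gradSq r (u t) x)
          ≤ ((∫ x in box 2 1, gradSq r (u 0) x)
              + C * Real.exp (ν * t) * Real.exp (-η * t) * N ^ (2 * r) / (ν * η))
            * Real.exp (C * (1 + HnormSq 1 0 (u 0) + HnormSq 1 0 (b 0)) / η ^ 2)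
            * Real.exp (-ν * t) := by
  set K := TorusCalculus.energyConst r with hK
  refine ⟨1 + K ^ 2 + K ^ 2 * C₁ ^ 4, by positivity, ?_⟩
  intro ν η N hη hν hN u b P h hu hb hj t ht
  have key := h.velocity_decay hη (by linarith) hu hb r ht hK rfl rfl
  set C := 1 + K ^ 2 + K ^ 2 * C₁ ^ 4 with hC
  set G := HnormSq 1 0 (u 0) + HnormSq 1 0 (b 0) with hG
  set E := (∫ x in box 2 1, gradSq r (u 0) x) + ∫ x in box 2 1, gradSq r (b 0) x with hE
  set Y := ∫ x in box 2 1, gradSq r (u 0) x with hY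
  have Y0 : 0 ≤ Y := integral_nonneg fun x => gradSq_nonneg r _ x
  have hν0 : 0 < ν := by linarith
  have nonneg : ∀ j w, 0 ≤ Hnorm (d := 2) (k := 2) 1 j w := fun _ _ => Real.sqrt_nonneg _
  have G0 : 0 ≤ G := by rw [hG, HnormSq_eq_sq, HnormSq_eq_sq]; positivity
  have G1 : G ≤ C₁ ^ 2 := by
    rw [hG, HnormSq_eq_sq, HnormSq_eq_sq]
    exact sq_add_sq_le_of_add_le (nonneg _ _) (nonneg _ _) (by simpa using hj 0 (Nat.zero_le r))
  have E1 : E ≤ C₁ ^ 2 * N ^ (2 * r) := by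
    have := sq_add_sq_le_of_add_le (nonneg _ _) (nonneg _ _) (hj r le_rfl)
    rw [mul_pow, ← pow_mul, mul_comm r 2] at this
    exact (add_le_add (integral_gradSq_le_Hnorm_sq _ _ _)
      (integral_gradSq_le_Hnorm_sq _ _ _)).trans this
  have N0 : (0 : ℝ) ≤ N ^ (2 * r) := by positivity
  have GE : K ^ 2 * G * E ≤ C * N ^ (2 * r) := by
    calc K ^ 2 * G * E ≤ K ^ 2 * G * (C₁ ^ 2 * N ^ (2 * r)) :=
          mul_le_mul_of_nonneg_left E1 (by positivity)
      _ ≤ K ^ 2 * C₁ ^ 2 * (C₁ ^ 2 * N ^ (2 * r)) := by gcongr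
      _ = K ^ 2 * C₁ ^ 4 * N ^ (2 * r) := by ring
      _ ≤ C * N ^ (2 * r) := by
          refine mul_le_mul_of_nonneg_right ?_ N0
          rw [hC]
          linarith [sq_nonneg K]
  set e := exp (K ^ 2 / (4 * η ^ 2) * G) with he
  have e1 : 1 ≤ e := Real.one_le_exp (by positivity)
  have e2 : e * e ≤ exp (C * (1 + HnormSq 1 0 (u 0) + HnormSq 1 0 (b 0)) / η ^ 2) := by
    rw [he, ← Real.exp_add, Real.exp_le_exp, add_assoc, ← hG]
    have : K ^ 2 / (4 * η ^ 2) * G + K ^ 2 / (4 * η ^ 2) * G = K ^ 2 / 2 * G / η ^ 2 := by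
      field_simp; ring
    rw [this]
    gcongr
    · rw [hC]
      have : 0 ≤ K ^ 2 * C₁ ^ 4 := by positivity
      linarith [sq_nonneg K]
    · linarith
  have hexp : exp (ν * t) * exp (-η * t) = exp ((ν - η) * t) := by
    rw [← Real.exp_add]; ring_nf
  refine key.trans (mul_le_mul_of_nonneg_right ?_ (Real.exp_pos _).le)
  rw [mul_assoc C, hexp]
  set X := exp ((ν - η) * t)
  have X0 : 0 < X := Real.exp_pos _
  calc (Y + K ^ 2 * G * e / (ν * η) * X * E) * e
      = Y * e + K ^ 2 * G * E * (X / (ν * η)) * (e * e) := by ring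
    _ ≤ Y * (e * e) + C * N ^ (2 * r) * (X / (ν * η)) * (e * e) := by
        gcongr
        exact le_mul_of_one_le_left (by linarith) e1
    _ = (Y + C * X * N ^ (2 * r) / (ν * η)) * (e * e) := by ring
    _ ≤ _ := mul_le_mul_of_nonneg_left e2 (by positivity)

end
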